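/- Let g : ℝⁿ → Sym⁺_d(ℝ) be C² with ∫_{ℝⁿ} |g| < ∞, and define LΨ := ΔΨ + Σ_{k=1}^n (g⁻¹ ∂_{x_k} g) ∂_{x_k} Ψ. Then the set H := {LΨ : Ψ : ℝⁿ → ℝ^d of class C² and compactly supported} is dense in {F ∈ L²(g) : ∫_{ℝⁿ} g(x)F(x) dx = 0} for the L²(g) norm; equivalently, for every Borel F : ℝⁿ → ℝ^d with ∫⟨g F, F⟩ dx < ∞ and ∫ g(x)F(x) dx = 0, and every ε > 0, there exists a C² compactly supported Ψ : ℝⁿ → ℝ^d with ∫_{ℝⁿ} ‖F(x) − LΨ(x)‖²_{g(x)} dx < ε. -/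

import Mathlib

open Matrix MeasureTheory

noncomputable section

/-- Entrywise partial derivative, in direction `x_j`, of a matrix-valued function. -/
def mpd {n d : ℕ} (j : Fin n) (g : (Fin n → ℝ) → Matrix (Fin d) (Fin d) ℝ)
    (x : Fin n → ℝ) : Matrix (Fin d) (Fin d) ℝ :=
  Matrix.of fun i k => fderiv ℝ (fun y => g y i k) x (Pi.single j 1)

/-- `θ^g_{j,k}(x) = g(x)⁻¹ (∂²_{x_k x_j} g(x) − (∂_{x_k} g)(x) g(x)⁻¹ (∂_{x_j} g)(x))`. -/
def theta {n d : ℕ} (g : (Fin n → ℝ) → Matrix (Fin d) (Fin d) ℝ) (j k : Fin n)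
    (x : Fin n → ℝ) : Matrix (Fin d) (Fin d) ℝ :=
  (g x)⁻¹ * (mpd k (mpd j g) x - mpd k g x * (g x)⁻¹ * mpd j g x)

/-- The operator `Θ^g(x)` on `M_{d,n}(ℝ)`: a `d×n` matrix is encoded by its columns
`U : Fin n → Fin d → ℝ`, and the `k`-th column of `Θ^g(x) U` is `Σ_j θ^g_{j,k}(x) u_j`. -/
def ThetaOp {n d : ℕ} (g : (Fin n → ℝ) → Matrix (Fin d) (Fin d) ℝ)
    (x : Fin n → ℝ) (U : Fin n → Fin d → ℝ) : Fin n → Fin d → ℝ :=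
  fun k => ∑ j, (theta g j k x).mulVec (U j)

/-- `⟨U,V⟩_{id_n ⊗ a} = Σ_k ⟨a u_k, v_k⟩` on `M_{d,n}(ℝ)` (matrices given by columns). -/
def minner {n d : ℕ} (a : Matrix (Fin d) (Fin d) ℝ)
    (U V : Fin n → Fin d → ℝ) : ℝ :=
  ∑ k, a.mulVec (U k) ⬝ᵥ V k

/-- `‖u‖²_a = ⟨a u, u⟩` on `ℝ^d`. -/
def vnormSq {d : ℕ} (a : Matrix (Fin d) (Fin d) ℝ) (u : Fin d → ℝ) : ℝ :=
  a.mulVec u ⬝ᵥ u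

/-- N-log-concavity: `⟨Θ^g(x) U, U⟩_{id_n ⊗ g(x)} ≤ 0` for all `x` and `U`. -/
def NLogConcave {n d : ℕ} (g : (Fin n → ℝ) → Matrix (Fin d) (Fin d) ℝ) : Prop :=
  ∀ (x : Fin n → ℝ) (U : Fin n → Fin d → ℝ), minner (g x) (ThetaOp g x U) U ≤ 0

/-- Entrywise `C^k` smoothness of a matrix-valued function. -/
def MatCD {n d : ℕ} (k : ℕ) (g : (Fin n → ℝ) → Matrix (Fin d) (Fin d) ℝ) : Prop :=
  ∀ i j, ContDiff ℝ k fun y => g y i j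

/-- Polar of a nonnegative quadratic form `Q` with respect to a bilinear pairing `inn`:
`Q°(v) = sup { ⟨u,v⟩² : Q(u) ≤ 1 }`. -/
def polar {E : Type*} (inn : E → E → ℝ) (Q : E → ℝ) (v : E) : ℝ :=
  sSup {r | ∃ u, Q u ≤ 1 ∧ r = inn u v ^ 2}

/-- Partial derivative `∂_{x_j} F` of a vector-valued function. -/
def pdF {n d : ℕ} (j : Fin n) (F : (Fin n → ℝ) → Fin d → ℝ) (x : Fin n → ℝ) : Fin d → ℝ :=
  fun i => fderiv ℝ (fun y => F y i) x (Pi.single j 1)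

/-- `∇_x F = [∂_{x_1} F, …, ∂_{x_n} F] ∈ M_{d,n}(ℝ)`, encoded by columns. -/
def gradM {n d : ℕ} (F : (Fin n → ℝ) → Fin d → ℝ) (x : Fin n → ℝ) :
    Fin n → Fin d → ℝ :=
  fun j => pdF j F x

/-- The operator `L F = Δ F + Σ_k (g⁻¹ ∂_{x_k} g) ∂_{x_k} F`. -/
def Lop {n d : ℕ} (g : (Fin n → ℝ) → Matrix (Fin d) (Fin d) ℝ)
    (F : (Fin n → ℝ) → Fin d → ℝ) (x : Fin n → ℝ) : Fin d → ℝ :=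
  (∑ k, pdF k (pdF k F) x) + ∑ k, ((g x)⁻¹ * mpd k g x).mulVec (pdF k F x)

/-- `Θ^g(x)` realized as a `dn × dn` matrix acting on `ℝ^{n×d} ≅ M_{d,n}(ℝ)`. -/
def ThetaMat {n d : ℕ} (g : (Fin n → ℝ) → Matrix (Fin d) (Fin d) ℝ)
    (x : Fin n → ℝ) : Matrix (Fin n × Fin d) (Fin n × Fin d) ℝ :=
  Matrix.of fun p q => theta g q.1 p.1 x p.2 q.2

/-- Identification `M_{d,n}(ℝ) → ℝ^{n×d}`. -/
def toVec {n d : ℕ} (U : Fin n → Fin d → ℝ) : Fin n × Fin d → ℝ := fun p => U p.1 p.2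

/-- Identification `ℝ^{n×d} → M_{d,n}(ℝ)`. -/
def ofVec {n d : ℕ} (v : Fin n × Fin d → ℝ) : Fin n → Fin d → ℝ := fun k i => v (k, i)

/-- The block `Θ^g_{0,0}` on `M_{d,n0}(ℝ)`. -/
def Theta00 {n0 n1 d : ℕ} (g : (Fin (n0 + n1) → ℝ) → Matrix (Fin d) (Fin d) ℝ)
    (x : Fin (n0 + n1) → ℝ) (V : Fin n0 → Fin d → ℝ) : Fin n0 → Fin d → ℝ :=
  fun k => ∑ j, (theta g (Fin.castAdd n1 j) (Fin.castAdd n1 k) x).mulVec (V j)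

/-- The mixed block `Θ^g_{0,1} : M_{d,n0}(ℝ) → M_{d,n1}(ℝ)`. -/
def Theta01 {n0 n1 d : ℕ} (g : (Fin (n0 + n1) → ℝ) → Matrix (Fin d) (Fin d) ℝ)
    (x : Fin (n0 + n1) → ℝ) (V : Fin n0 → Fin d → ℝ) : Fin n1 → Fin d → ℝ :=
  fun k => ∑ j, (theta g (Fin.castAdd n1 j) (Fin.natAdd n0 k) x).mulVec (V j)

/-- The block `Θ^g_{1,1}` on `M_{d,n1}(ℝ)`. -/
def Theta11 {n0 n1 d : ℕ} (g : (Fin (n0 + n1) → ℝ) → Matrix (Fin d) (Fin d) ℝ)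
    (x : Fin (n0 + n1) → ℝ) (W : Fin n1 → Fin d → ℝ) : Fin n1 → Fin d → ℝ :=
  fun k => ∑ j, (theta g (Fin.natAdd n0 j) (Fin.natAdd n0 k) x).mulVec (W j)

/-- The block `Θ^g_{1,1}` realized as a `d n1 × d n1` matrix. -/
def Theta11Mat {n0 n1 d : ℕ} (g : (Fin (n0 + n1) → ℝ) → Matrix (Fin d) (Fin d) ℝ)
    (x : Fin (n0 + n1) → ℝ) : Matrix (Fin n1 × Fin d) (Fin n1 × Fin d) ℝ :=
  Matrix.of fun p q => theta g (Fin.natAdd n0 q.1) (Fin.natAdd n0 p.1) x p.2 q.2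

/-- The `dn × dn` matrix `Θ̃^g(x)` with `(j,k)` block `g(x) θ^g_{j,k}(x)`. -/
def tThetaMat {n d : ℕ} (g : (Fin n → ℝ) → Matrix (Fin d) (Fin d) ℝ)
    (x : Fin n → ℝ) : Matrix (Fin n × Fin d) (Fin n × Fin d) ℝ :=
  Matrix.of fun p q => (g x * theta g q.1 p.1 x) p.2 q.2

/-- Hessian matrix of a scalar function on `ℝⁿ`. -/
def Hess {n : ℕ} (φ : (Fin n → ℝ) → ℝ) (y : Fin n → ℝ) : Matrix (Fin n) (Fin n) ℝ :=
  Matrix.of fun j k => fderiv ℝ (fun z => fderiv ℝ φ z (Pi.single k 1)) y (Pi.single j 1)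

/-- Gradient of a scalar function on `ℝⁿ`. -/
def gradV {n : ℕ} (u : (Fin n → ℝ) → ℝ) (y : Fin n → ℝ) : Fin n → ℝ :=
  fun j => fderiv ℝ u y (Pi.single j 1)

/-- A measurable field of positive semidefinite matrices has a measurable symmetric square root. -/
theorem exists_measurable_matrix_sqrt {X ι : Type*} [MeasurableSpace X] [Fintype ι]
    [DecidableEq ι] (g : X → Matrix ι ι ℝ) (hg : ∀ i j, Measurable fun x => g x i j)
    (hpos : ∀ x, (g x).PosSemidef) :
    ∃ S : X → Matrix ι ι ℝ, (∀ i j, Measurable fun x => S x i j) ∧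
      (∀ x, (S x)ᵀ = S x) ∧ ∀ x, S x * S x = g x := by
  have hp : ∀ k : ℕ, ∃ p : Polynomial ℝ, ∀ t ∈ Set.Icc (0 : ℝ) k,
      |p.eval t - Real.sqrt t| < 1 / ((k : ℝ) + 1) := fun k =>
    exists_polynomial_near_of_continuousOn 0 k _ Real.continuous_sqrt.continuousOn _
      (by positivity)
  choose p hp using hp
  have hsa : ∀ x, IsSelfAdjoint (g x) := fun x => (hpos x).isHermitian
  have hspec : ∀ x, ∀ t ∈ spectrum ℝ (g x), 0 ≤ t := by
    intro x t ht
    rw [(hpos x).isHermitian.spectrum_real_eq_range_eigenvalues] at ht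
    obtain ⟨i, rfl⟩ := ht
    exact (hpos x).eigenvalues_nonneg i
  have hpow : ∀ (m : ℕ) i j, Measurable fun x => (g x ^ m) i j := by
    intro m
    induction m with
    | zero => intro i j; simp
    | succ m ih =>
      intro i j
      simp only [pow_succ, Matrix.mul_apply]
      exact Finset.measurable_sum _ fun l _ => (ih i l).mul (hg l j)
  refine ⟨fun x => cfc Real.sqrt (g x), fun i j => ?_, fun x => ?_, fun x => ?_⟩
  · refine measurable_of_tendsto_metrizable
      (f := fun k x => (Polynomial.aeval (g x) (p k)) i j) (fun k => ?_) ?_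
    · simp only [Polynomial.aeval_eq_sum_range, Matrix.sum_apply, Matrix.smul_apply]
      exact Finset.measurable_sum _ fun l _ => (hpow l i j).const_mul _
    · rw [tendsto_pi_nhds]
      intro x
      have h : Filter.Tendsto (fun k => cfc (fun t => (p k).eval t) (g x)) Filter.atTop
          (nhds (cfc Real.sqrt (g x))) := by
        refine tendsto_cfc_fun ?_ (Filter.Eventually.of_forall fun k =>
          (p k).continuous.continuousOn)
        rw [Metric.tendstoUniformlyOn_iff]
        intro ε hε
        obtain ⟨b, hb⟩ := (ContinuousFunctionalCalculus.isCompact_spectrum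
          (R := ℝ) (p := IsSelfAdjoint) (g x)).bddAbove
        filter_upwards [Filter.eventually_ge_atTop ⌈b⌉₊,
          (tendsto_one_div_add_atTop_nhds_zero_nat (𝕜 := ℝ)).eventually (gt_mem_nhds hε)]
          with k hk hk' t ht
        have : t ≤ k := (hb ht).trans ((Nat.le_ceil b).trans (by exact_mod_cast hk))
        rw [dist_comm, Real.dist_eq]
        exact (hp k t ⟨hspec x t ht, this⟩).trans hk'
      simp only [cfc_polynomial _ _ (hsa _)] at h
      exact ((continuous_apply j).comp (continuous_apply i)).continuousAt.tendsto.comp h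
  · have : IsSelfAdjoint (cfc Real.sqrt (g x)) := cfc_predicate _ _
    simpa [IsSelfAdjoint, Matrix.star_eq_conjTranspose] using this
  · change cfc Real.sqrt (g x) * cfc Real.sqrt (g x) = g x
    rw [← cfc_mul _ _ _ Real.continuous_sqrt.continuousOn Real.continuous_sqrt.continuousOn]
    conv_rhs => rw [← cfc_id' ℝ (g x) (hsa x)]
    exact cfc_congr fun t ht => Real.mul_self_sqrt (hspec x t ht)

/-- A continuous family of `2`-homogeneous functions that is positive on the diagonal of the
parameter space is nonnegative near the diagonal, uniformly over compact sets. -/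
theorem exists_nonneg_near_diagonal {E V : Type*} [MetricSpace E] [NormedAddCommGroup V]
    [NormedSpace ℝ V] [FiniteDimensional ℝ V] (q : E → E → V → ℝ)
    (hq : Continuous fun p : E × E × V => q p.1 p.2.1 p.2.2)
    (hhom : ∀ x y (t : ℝ) v, q x y (t • v) = t ^ 2 * q x y v)
    (hpos : ∀ x v, v ≠ 0 → 0 < q x x v) {K : Set E} (hK : IsCompact K) :
    ∃ ε > 0, ∀ x ∈ K, ∀ y, dist x y < ε → ∀ v, 0 ≤ q x y v := by
  have : ProperSpace V := FiniteDimensional.proper_real V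
  have hC : IsCompact ((fun p : E × V => (p.1, p.1, p.2)) '' (K ×ˢ Metric.sphere (0 : V) 1)) :=
    (hK.prod (isCompact_sphere 0 1)).image (by fun_prop)
  obtain ⟨ε, hε, hsub⟩ := hC.exists_thickening_subset_open (isOpen_lt continuous_const hq) (by
    rintro _ ⟨⟨x, v⟩, ⟨_, hv⟩, rfl⟩
    refine hpos x v ?_
    rintro rfl
    simp at hv)
  refine ⟨ε, hε, fun x hx y hxy v => ?_⟩
  by_cases hv : v = 0
  · subst hv
    simpa using (hhom x y 0 0).ge
  have hn : 0 < ‖v‖ := norm_pos_iff.2 hv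
  have hmem : (x, y, ‖v‖⁻¹ • v) ∈ {p : E × E × V | 0 < q p.1 p.2.1 p.2.2} := by
    apply hsub
    rw [Metric.mem_thickening_iff]
    refine ⟨_, ⟨(x, ‖v‖⁻¹ • v), ⟨hx, by simp [norm_smul, hn.ne']⟩, rfl⟩, ?_⟩
    simp [Prod.dist_eq, dist_comm y x, hxy]
  have h := hhom x y ‖v‖ (‖v‖⁻¹ • v)
  rw [smul_smul, mul_inv_cancel₀ hn.ne', one_smul] at h
  rw [h]
  exact mul_nonneg (sq_nonneg _) (le_of_lt hmem)

/-- The `L¹` modulus of continuity of a `C¹` function is controlled by its derivative. -/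
theorem lintegral_enorm_sub_translate_le {E : Type*} [NormedAddCommGroup E] [NormedSpace ℝ E]
    [MeasurableSpace E] [BorelSpace E] [FiniteDimensional ℝ E] (μ : Measure E)
    [μ.IsAddHaarMeasure] {f : E → ℝ} (hf : ContDiff ℝ 1 f) (v : E) (R : ℝ) :
    ∫⁻ x in Metric.closedBall 0 R, ‖f (x + v) - f x‖ₑ ∂μ ≤
      ∫⁻ x in Metric.closedBall 0 (R + ‖v‖), ‖fderiv ℝ f x v‖ₑ ∂μ := by
  have hcont : Continuous fun x => fderiv ℝ f x v :=
    (hf.continuous_fderiv one_ne_zero).clm_apply continuous_const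
  have hftc : ∀ x, ‖f (x + v) - f x‖ₑ ≤
      ∫⁻ s in Set.Ioc (0 : ℝ) 1, ‖fderiv ℝ f (x + s • v) v‖ₑ := by
    intro x
    have hd : ∀ s ∈ Set.uIcc (0 : ℝ) 1,
        HasDerivAt (fun s : ℝ => f (x + s • v)) (fderiv ℝ f (x + s • v) v) s := by
      intro s _
      have h1 : HasDerivAt (fun s : ℝ => x + s • v) v s := by
        simpa using ((hasDerivAt_id s).smul_const v).const_add x
      exact ((hf.differentiable one_ne_zero _).hasFDerivAt).comp_hasDerivAt s h1
    have h := intervalIntegral.integral_eq_sub_of_hasDerivAt hd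
      ((hcont.comp (by fun_prop : Continuous fun s : ℝ => x + s • v)).intervalIntegrable 0 1)
    simp only [one_smul, zero_smul, add_zero] at h
    rw [← h, intervalIntegral.integral_of_le zero_le_one]
    exact enorm_integral_le_lintegral_enorm _
  have hmeas : Measurable fun p : E × ℝ => ‖fderiv ℝ f (p.1 + p.2 • v) v‖ₑ :=
    (hcont.comp (by fun_prop : Continuous fun p : E × ℝ => p.1 + p.2 • v)).measurable.enorm
  calc ∫⁻ x in Metric.closedBall 0 R, ‖f (x + v) - f x‖ₑ ∂μ
      ≤ ∫⁻ x in Metric.closedBall 0 R,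
          (∫⁻ s in Set.Ioc (0 : ℝ) 1, ‖fderiv ℝ f (x + s • v) v‖ₑ) ∂μ :=
        lintegral_mono hftc
    _ = ∫⁻ s in Set.Ioc (0 : ℝ) 1,
          (∫⁻ x in Metric.closedBall 0 R, ‖fderiv ℝ f (x + s • v) v‖ₑ ∂μ) :=
        lintegral_lintegral_swap hmeas.aemeasurable
    _ ≤ ∫⁻ s in Set.Ioc (0 : ℝ) 1,
          ∫⁻ x in Metric.closedBall 0 (R + ‖v‖), ‖fderiv ℝ f x v‖ₑ ∂μ := by
        refine setLIntegral_mono measurable_const fun s hs => ?_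
        rw [← lintegral_indicator Metric.isClosed_closedBall.measurableSet,
          ← lintegral_indicator Metric.isClosed_closedBall.measurableSet,
          ← lintegral_add_right_eq_self (μ := μ)
            ((Metric.closedBall 0 (R + ‖v‖)).indicator fun x => ‖fderiv ℝ f x v‖ₑ) (s • v)]
        refine lintegral_mono fun x => ?_
        refine Set.indicator_apply_le' (fun hx => ?_) fun _ => zero_le
        rw [Set.indicator_of_mem]
        rw [mem_closedBall_zero_iff] at hx ⊢
        calc ‖x + s • v‖ ≤ ‖x‖ + ‖s • v‖ := norm_add_le _ _
          _ ≤ R + ‖v‖ := by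
            rw [norm_smul, Real.norm_of_nonneg hs.1.le]
            nlinarith [hs.2, norm_nonneg v]
    _ = _ := by simp

/-- A measurable function that is almost everywhere invariant under each translation is almost
everywhere constant. -/
theorem ae_const_of_translation_invariant {E : Type*} [NormedAddCommGroup E] [NormedSpace ℝ E]
    [MeasurableSpace E] [BorelSpace E] [FiniteDimensional ℝ E] (μ : Measure E)
    [μ.IsAddHaarMeasure] {f : E → ℝ} (hf : Measurable f)
    (h : ∀ v, ∀ᵐ x ∂μ, f (x + v) = f x) : ∃ c, ∀ᵐ x ∂μ, f x = c := by
  have hm : MeasurableSet {p : E × E | f (p.2 + p.1) = f p.2} :=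
    measurableSet_eq_fun (hf.comp (measurable_snd.add measurable_fst)) (hf.comp measurable_snd)
  have h1 : ∀ᵐ p ∂(μ.prod μ), f (p.2 + p.1) = f p.2 :=
    (Measure.ae_prod_iff_ae_ae hm).2 (Filter.Eventually.of_forall h)
  have h2 : ∀ᵐ x ∂μ, ∀ᵐ v ∂μ, f (x + v) = f x := Measure.ae_ae_comm hm |>.1
    (Filter.Eventually.of_forall h)
  obtain ⟨x, hx⟩ := h2.exists
  refine ⟨f x, ?_⟩
  have := (measurePreserving_add_left μ (-x)).quasiMeasurePreserving.ae hx
  simpa using this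

/-- An almost everywhere limit of `C¹` functions whose gradients tend to zero in `L²` on every
ball is almost everywhere constant. -/
theorem ae_const_of_tendsto_of_gradient {n : ℕ} {f : ℕ → (Fin n → ℝ) → ℝ}
    (hf : ∀ m, ContDiff ℝ 1 (f m)) {F : (Fin n → ℝ) → ℝ} (hF : Measurable F)
    (hlim : ∀ᵐ x, Filter.Tendsto (fun m => f m x) Filter.atTop (nhds (F x)))
    (hgrad : ∀ (R : ℝ) (k : Fin n), Filter.Tendsto (fun m =>
      ∫ x in Metric.closedBall 0 R, (fderiv ℝ (f m) x (Pi.single k 1)) ^ 2)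
      Filter.atTop (nhds 0)) :
    ∃ c, ∀ᵐ x, F x = c := by
  refine ae_const_of_translation_invariant volume hF fun v => ?_
  have hcont : ∀ m w, Continuous fun x => fderiv ℝ (f m) x w := fun m w =>
    ((hf m).continuous_fderiv one_ne_zero).clm_apply continuous_const
  have hone : ∀ (R : ℝ) (k : Fin n), Filter.Tendsto (fun m =>
      ∫ x in Metric.closedBall 0 R, |fderiv ℝ (f m) x (Pi.single k 1)|)
      Filter.atTop (nhds 0) := by
    intro R k
    set B := volume.real (Metric.closedBall (0 : Fin n → ℝ) R) with hB
    have hB0 : 0 ≤ B := measureReal_nonneg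
    refine Metric.tendsto_atTop'.2 fun ε hε => ?_
    set s := ε / (2 * (B + 1)) with hs
    have hs0 : 0 < s := by positivity
    obtain ⟨N, hN⟩ := Metric.tendsto_atTop'.1 (hgrad R k) (s * ε / 2) (by positivity)
    refine ⟨N, fun m hm => ?_⟩
    have h1 := hN m hm
    have hnn : 0 ≤ ∫ x in Metric.closedBall 0 R, |fderiv ℝ (f m) x (Pi.single k 1)| :=
      integral_nonneg fun x => abs_nonneg _
    rw [Real.dist_eq, sub_zero] at h1 ⊢
    rw [abs_of_nonneg hnn]
    have h2 : ∫ x in Metric.closedBall 0 R, |fderiv ℝ (f m) x (Pi.single k 1)| ≤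
        ∫ x in Metric.closedBall 0 R,
          (s + s⁻¹ * (fderiv ℝ (f m) x (Pi.single k 1)) ^ 2) := by
      refine integral_mono ?_ ?_ fun x => ?_
      · exact ((hcont m _).abs.continuousOn).integrableOn_compact (isCompact_closedBall _ _)
      · exact (by have := hcont m (Pi.single k 1); fun_prop : Continuous fun x =>
          s + s⁻¹ * (fderiv ℝ (f m) x (Pi.single k 1)) ^ 2).continuousOn.integrableOn_compact
          (isCompact_closedBall _ _)
      · set a := fderiv ℝ (f m) x (Pi.single k 1)
        change |a| ≤ s + s⁻¹ * a ^ 2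
        have : s * |a| ≤ s * (s + s⁻¹ * a ^ 2) := by
          rw [mul_add, ← mul_assoc, mul_inv_cancel₀ hs0.ne', one_mul, ← sq_abs a]
          nlinarith [sq_nonneg (s - |a|), abs_nonneg a]
        exact le_of_mul_le_mul_left this hs0
    rw [integral_add, integral_const_mul] at h2
    · simp only [integral_const, smul_eq_mul, measureReal_restrict_apply MeasurableSet.univ,
        Set.univ_inter, ← hB] at h2
      have h3 : B * s < ε / 2 := by
        rw [hs, ← mul_div_assoc, div_lt_div_iff₀ (by positivity) (by positivity)]
        nlinarith
      have h4 : s⁻¹ * (∫ x in Metric.closedBall 0 R,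
          (fderiv ℝ (f m) x (Pi.single k 1)) ^ 2) < ε / 2 := by
        rw [inv_mul_lt_iff₀ hs0]
        have := (le_abs_self _).trans_lt h1
        linarith
      linarith
    · exact integrableOn_const (isCompact_closedBall _ _).measure_lt_top.ne
    · exact ((by have := hcont m (Pi.single k 1); fun_prop : Continuous fun x =>
          s⁻¹ * (fderiv ℝ (f m) x (Pi.single k 1)) ^ 2).continuousOn.integrableOn_compact
          (isCompact_closedBall _ _))
  have hR : ∀ R : ℝ, ∀ᵐ x ∂(volume.restrict (Metric.closedBall 0 R)), F (x + v) = F x := by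
    intro R
    have hlin : Filter.Tendsto (fun m => ∫⁻ x in Metric.closedBall 0 R,
        ‖f m (x + v) - f m x‖ₑ) Filter.atTop (nhds 0) := by
      have hbd : ∀ m, ∫⁻ x in Metric.closedBall 0 R, ‖f m (x + v) - f m x‖ₑ ≤
          ENNReal.ofReal (∑ k, |v k| * ∫ x in Metric.closedBall 0 (R + ‖v‖),
            |fderiv ℝ (f m) x (Pi.single k 1)|) := by
        intro m
        have hint : ∀ k, IntegrableOn (fun x => |v k| * |fderiv ℝ (f m) x (Pi.single k 1)|)
            (Metric.closedBall 0 (R + ‖v‖)) := fun k =>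
          ((hcont m _).abs.const_mul _).continuousOn.integrableOn_compact
            (isCompact_closedBall _ _)
        refine (lintegral_enorm_sub_translate_le volume (hf m) v R).trans ?_
        simp_rw [← integral_const_mul]
        rw [← integral_finsetSum _ fun k _ => hint k,
          ofReal_integral_eq_lintegral_ofReal (integrable_finsetSum _ fun k _ => hint k)
          (Filter.Eventually.of_forall fun x => by positivity)]
        refine lintegral_mono fun x => ?_
        rw [← ofReal_norm]
        refine ENNReal.ofReal_le_ofReal ?_
        have hv : v = ∑ k, v k • Pi.single k (1 : ℝ) := by
          ext i; simp [Finset.sum_apply, Pi.single_apply]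
        conv_lhs => rw [hv, map_sum]
        refine (norm_sum_le _ _).trans (Finset.sum_le_sum fun k _ => ?_)
        rw [map_smul, norm_smul, Real.norm_eq_abs, Real.norm_eq_abs]
      refine tendsto_of_tendsto_of_tendsto_of_le_of_le tendsto_const_nhds ?_
        (fun _ => zero_le) hbd
      rw [← ENNReal.ofReal_zero]
      refine ENNReal.tendsto_ofReal ?_
      have := tendsto_finsetSum (Finset.univ : Finset (Fin n)) fun k _ =>
        (hone (R + ‖v‖) k).const_mul |v k|
      simpa using this
    have hfat := lintegral_liminf_le (μ := volume.restrict (Metric.closedBall 0 R))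
      (u := Filter.atTop) (f := fun m x => ‖f m (x + v) - f m x‖ₑ)
      fun m => (((hf m).continuous.comp (continuous_add_const v)).sub
        (hf m).continuous).measurable.enorm
    rw [hlin.liminf_eq] at hfat
    have hz : ∫⁻ x in Metric.closedBall 0 R, ‖F (x + v) - F x‖ₑ = 0 := by
      refine le_antisymm (le_trans (le_of_eq (lintegral_congr_ae ?_)) hfat) zero_le
      refine ae_restrict_of_ae ?_
      filter_upwards [hlim,
        (measurePreserving_add_right volume v).quasiMeasurePreserving.ae hlim] with x hx hx'
      exact ((continuous_enorm.tendsto _).comp (hx'.sub hx)).liminf_eq.symm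
    rw [lintegral_eq_zero_iff (by fun_prop)] at hz
    filter_upwards [hz] with x hx
    simpa [sub_eq_zero] using hx
  have : ∀ᵐ x, ∀ m : ℕ, x ∈ Metric.closedBall (0 : Fin n → ℝ) m → F (x + v) = F x := by
    rw [ae_all_iff]
    exact fun m => (ae_restrict_iff' Metric.isClosed_closedBall.measurableSet).1 (hR m)
  filter_upwards [this] with x hx
  exact hx ⌈‖x‖⌉₊ (by simpa using Nat.le_ceil ‖x‖)

/-- The partial derivative `∂_{x_k} f` of a scalar function. -/
def pd {n : ℕ} (k : Fin n) (f : (Fin n → ℝ) → ℝ) (x : Fin n → ℝ) : ℝ :=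
  fderiv ℝ f x (Pi.single k 1)

theorem contDiff_pd {n : ℕ} (k : Fin n) {f : (Fin n → ℝ) → ℝ} {m l : WithTop ℕ∞}
    (hf : ContDiff ℝ m f) (h : l + 1 ≤ m) : ContDiff ℝ l (pd k f) :=
  (hf.fderiv_right h).clm_apply contDiff_const

theorem hasCompactSupport_pd {n : ℕ} (k : Fin n) {f : (Fin n → ℝ) → ℝ}
    (hf : HasCompactSupport f) : HasCompactSupport (pd k f) :=
  hf.fderiv_apply ℝ _

theorem pd_mul {n : ℕ} (k : Fin n) {f h : (Fin n → ℝ) → ℝ} {x : Fin n → ℝ}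
    (hf : DifferentiableAt ℝ f x) (hh : DifferentiableAt ℝ h x) :
    pd k (fun y => f y * h y) x = pd k f x * h x + f x * pd k h x := by
  simp only [pd]
  rw [fderiv_fun_mul hf hh]
  simp
  ring

theorem pd_sub {n : ℕ} (k : Fin n) {f h : (Fin n → ℝ) → ℝ} {x : Fin n → ℝ}
    (hf : DifferentiableAt ℝ f x) (hh : DifferentiableAt ℝ h x) :
    pd k (fun y => f y - h y) x = pd k f x - pd k h x := by
  simp only [pd]
  rw [fderiv_fun_sub hf hh]
  simp

theorem pd_sum {n : ℕ} (k : Fin n) {ι : Type*} [Fintype ι] {f : ι → (Fin n → ℝ) → ℝ}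
    {x : Fin n → ℝ} (hf : ∀ i, DifferentiableAt ℝ (f i) x) :
    pd k (fun y => ∑ i, f i y) x = ∑ i, pd k (f i) x := by
  simp only [pd]
  rw [fderiv_fun_sum fun i _ => hf i]
  simp

/-- The integral of a partial derivative of a compactly supported `C¹` function vanishes. -/
theorem integral_pd_eq_zero {n : ℕ} (k : Fin n) {f : (Fin n → ℝ) → ℝ}
    (hf : ContDiff ℝ 1 f) (hc : HasCompactSupport f) : ∫ x, pd k f x = 0 := by
  have hi : Integrable (pd k f) :=
    (contDiff_pd k hf (l := 0) (by simp)).continuous.integrable_of_hasCompactSupport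
      (hasCompactSupport_pd k hc)
  have hi' : Integrable f := hf.continuous.integrable_of_hasCompactSupport hc
  have h := integral_mul_fderiv_eq_neg_fderiv_mul_of_integrable (μ := volume)
    (f := fun _ : Fin n → ℝ => (1 : ℝ)) (g := f) (v := Pi.single k 1) (by simp)
    (by simp only [one_mul]; exact hi) (by simpa using hi')
    (fun _ _ => differentiableAt_const _) (fun _ _ => hf.differentiable one_ne_zero _)
  simpa [pd] using h

/-- The convolution `ρ * u`. -/
def mollify {n : ℕ} (ρ u : (Fin n → ℝ) → ℝ) (x : Fin n → ℝ) : ℝ :=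
  ∫ y, ρ (x - y) * u y

theorem mollify_eq_convolution {n : ℕ} (ρ u : (Fin n → ℝ) → ℝ) :
    mollify ρ u = convolution ρ u (ContinuousLinearMap.lsmul ℝ ℝ) volume := by
  ext x
  rw [convolution_eq_swap]
  simp [mollify]

theorem integrable_mollify_integrand {n : ℕ} {ρ u : (Fin n → ℝ) → ℝ} (hρ : Continuous ρ)
    (hc : HasCompactSupport ρ) (hu : LocallyIntegrable u) (x : Fin n → ℝ) :
    Integrable fun y => ρ (x - y) * u y := by
  have := (hc.convolutionExists_left (ContinuousLinearMap.lsmul ℝ ℝ) hρ hu x).integrable_swap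
  simpa using this

theorem contDiff_mollify {n : ℕ} {ρ u : (Fin n → ℝ) → ℝ} {m : ℕ∞} (hρ : ContDiff ℝ m ρ)
    (hc : HasCompactSupport ρ) (hu : LocallyIntegrable u) : ContDiff ℝ m (mollify ρ u) := by
  rw [mollify_eq_convolution]
  exact hc.contDiff_convolution_left _ hρ hu

theorem pd_mollify {n : ℕ} (k : Fin n) {ρ u : (Fin n → ℝ) → ℝ} (hρ : ContDiff ℝ 1 ρ)
    (hc : HasCompactSupport ρ) (hu : LocallyIntegrable u) :
    pd k (mollify ρ u) = mollify (pd k ρ) u := by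
  ext x
  have h := hc.hasFDerivAt_convolution_left (ContinuousLinearMap.lsmul ℝ ℝ) hρ hu x
  have hi := ((hc.fderiv ℝ).convolutionExists_left
    ((ContinuousLinearMap.lsmul ℝ ℝ).precompL (Fin n → ℝ))
    (hρ.continuous_fderiv one_ne_zero) hu x).integrable_swap
  rw [pd, mollify_eq_convolution, h.fderiv, convolution_eq_swap,
    ContinuousLinearMap.integral_apply hi]
  simp [mollify, pd, ContinuousLinearMap.precompL_apply]

theorem mollify_sum_mul {n : ℕ} {ι : Type*} [Fintype ι] {ρ : (Fin n → ℝ) → ℝ}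
    {u : ι → (Fin n → ℝ) → ℝ} (hρ : Continuous ρ) (hc : HasCompactSupport ρ)
    (hu : ∀ i, LocallyIntegrable (u i)) (c : ι → ℝ) (x : Fin n → ℝ) :
    mollify ρ (fun y => ∑ i, c i * u i y) x = ∑ i, c i * mollify ρ (u i) x := by
  simp only [mollify, Finset.mul_sum, ← integral_const_mul]
  rw [← integral_finsetSum _ fun i _ =>
    (integrable_mollify_integrand hρ hc (hu i) x).const_mul (c i)]
  exact integral_congr_ae (Filter.Eventually.of_forall fun y =>
    Finset.sum_congr rfl fun i _ => by ring)

theorem mollify_sub {n : ℕ} {ρ u w : (Fin n → ℝ) → ℝ} (hρ : Continuous ρ)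
    (hc : HasCompactSupport ρ) (hu : LocallyIntegrable u) (hw : LocallyIntegrable w)
    (x : Fin n → ℝ) :
    mollify ρ (fun y => u y - w y) x = mollify ρ u x - mollify ρ w x := by
  simp only [mollify]
  rw [← integral_sub (integrable_mollify_integrand hρ hc hu x)
    (integrable_mollify_integrand hρ hc hw x)]
  simp only [mul_sub]

/-- `ρ` is a smooth probability density supported in the ball of radius `ε`. -/
structure IsMollifier {n : ℕ} (ρ : (Fin n → ℝ) → ℝ) (ε : ℝ) : Prop where
  contDiff : ContDiff ℝ (⊤ : ℕ∞) ρ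
  hasCompactSupport : HasCompactSupport ρ
  nonneg : ∀ z, 0 ≤ ρ z
  integral_eq_one : ∫ z, ρ z = 1
  eq_zero_of_le : ∀ z, ε ≤ ‖z‖ → ρ z = 0

namespace IsMollifier

variable {n : ℕ} {ρ : (Fin n → ℝ) → ℝ} {ε : ℝ}

theorem abs_mollify_le (hρ : IsMollifier ρ ε) {b h : (Fin n → ℝ) → ℝ}
    (hh : LocallyIntegrable h) {α δ : ℝ} {x : Fin n → ℝ}
    (hle : ∀ y, dist x y < ε → |b y| ≤ α + δ * h y) :
    |mollify ρ b x| ≤ α + δ * mollify ρ h x := by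
  have hone : ∫ y, ρ (x - y) = 1 := by
    rw [integral_sub_left_eq_self (fun z => ρ z) volume x, hρ.integral_eq_one]
  have hi1 : Integrable fun y => ρ (x - y) :=
    (hρ.contDiff.continuous.integrable_of_hasCompactSupport hρ.hasCompactSupport).comp_sub_left x
  have hi2 := integrable_mollify_integrand hρ.contDiff.continuous hρ.hasCompactSupport hh x
  calc |mollify ρ b x| ≤ ∫ y, (α * ρ (x - y) + δ * (ρ (x - y) * h y)) := by
        rw [mollify, ← Real.norm_eq_abs]
        refine norm_integral_le_of_norm_le ((hi1.const_mul _).add (hi2.const_mul _))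
          (Filter.Eventually.of_forall fun y => ?_)
        rw [Real.norm_eq_abs, abs_mul, abs_of_nonneg (hρ.nonneg _)]
        rcases lt_or_ge (dist x y) ε with hxy | hxy
        · nlinarith [mul_le_mul_of_nonneg_left (hle y hxy) (hρ.nonneg (x - y))]
        · simp [hρ.eq_zero_of_le (x - y) (by rwa [← dist_eq_norm])]
    _ = α + δ * mollify ρ h x := by
        rw [integral_add (hi1.const_mul _) (hi2.const_mul _), integral_const_mul,
          integral_const_mul, hone, mollify, mul_one]

theorem integrable_mollify (hρ : IsMollifier ρ ε) {h : (Fin n → ℝ) → ℝ} (hh : Integrable h) :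
    Integrable (mollify ρ h) := by
  rw [mollify_eq_convolution]
  exact (hρ.contDiff.continuous.integrable_of_hasCompactSupport
    hρ.hasCompactSupport).integrable_convolution _ hh

theorem integral_mollify (hρ : IsMollifier ρ ε) {h : (Fin n → ℝ) → ℝ} (hh : Integrable h) :
    ∫ x, mollify ρ h x = ∫ x, h x := by
  rw [mollify_eq_convolution, integral_convolution _
    (hρ.contDiff.continuous.integrable_of_hasCompactSupport hρ.hasCompactSupport) hh,
    hρ.integral_eq_one]
  simp

theorem mollify_nonneg (hρ : IsMollifier ρ ε) {h : (Fin n → ℝ) → ℝ} (hh : ∀ x, 0 ≤ h x)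
    (x : Fin n → ℝ) : 0 ≤ mollify ρ h x :=
  integral_nonneg fun _ => mul_nonneg (hρ.nonneg _) (hh _)

end IsMollifier

section LinearAlgebra

variable {d : ℕ} {a : Matrix (Fin d) (Fin d) ℝ}

theorem vnormSq_nonneg (ha : a.PosSemidef) (u : Fin d → ℝ) : 0 ≤ vnormSq a u := by
  have := ha.dotProduct_mulVec_nonneg u
  rwa [star_trivial, dotProduct_comm] at this

theorem vnormSq_pos (ha : a.PosDef) {u : Fin d → ℝ} (hu : u ≠ 0) : 0 < vnormSq a u := by
  have := ha.dotProduct_mulVec_pos hu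
  rwa [star_trivial, dotProduct_comm] at this

theorem vnormSq_smul (t : ℝ) (u : Fin d → ℝ) : vnormSq a (t • u) = t ^ 2 * vnormSq a u := by
  simp only [vnormSq, mulVec_smul, smul_dotProduct, dotProduct_smul, smul_eq_mul]
  ring

theorem mulVec_dotProduct_comm (ha : aᵀ = a) (u w : Fin d → ℝ) :
    a *ᵥ u ⬝ᵥ w = u ⬝ᵥ a *ᵥ w := by
  rw [dotProduct_mulVec, ← mulVec_transpose, ha]

theorem vnormSq_smul_add_smul (ha : aᵀ = a) (s t : ℝ) (u w : Fin d → ℝ) :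
    vnormSq a (s • u + t • w) =
      s ^ 2 * vnormSq a u + 2 * s * t * (u ⬝ᵥ a *ᵥ w) + t ^ 2 * vnormSq a w := by
  simp only [vnormSq, mulVec_add, mulVec_smul, add_dotProduct, dotProduct_add, smul_dotProduct,
    dotProduct_smul, smul_eq_mul, mulVec_dotProduct_comm ha w u]
  rw [dotProduct_comm w (a *ᵥ u), mulVec_dotProduct_comm ha u w]
  ring

theorem transpose_eq_of_posSemidef (ha : a.PosSemidef) : aᵀ = a := by
  simpa using ha.isHermitian.eq

theorem abs_dotProduct_mulVec_le (ha : a.PosSemidef) (u w : Fin d → ℝ) :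
    |u ⬝ᵥ a *ᵥ w| ≤ 1 / 4 * vnormSq a u + vnormSq a w := by
  have h1 := vnormSq_nonneg ha ((1 / 2 : ℝ) • u + (1 : ℝ) • w)
  have h2 := vnormSq_nonneg ha ((1 / 2 : ℝ) • u + (-1 : ℝ) • w)
  rw [vnormSq_smul_add_smul (transpose_eq_of_posSemidef ha)] at h1 h2
  rw [abs_le]
  constructor <;> linarith

end LinearAlgebra

section Regularization

variable {n d : ℕ} {g : (Fin n → ℝ) → Matrix (Fin d) (Fin d) ℝ}

theorem MatCD.continuous {k : ℕ} (hg : MatCD k g) : Continuous g :=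
  continuous_matrix fun i j => (hg i j).continuous

theorem MatCD.contDiff_mpd (hg : MatCD 2 g) (k : Fin n) (i j : Fin d) :
    ContDiff ℝ 1 fun x => mpd k g x i j :=
  contDiff_pd k (hg i j) (by norm_num)

theorem MatCD.continuous_mpd (hg : MatCD 2 g) (k : Fin n) : Continuous (mpd k g) :=
  continuous_matrix fun i j => (hg.contDiff_mpd k i j).continuous

theorem contDiff_matrix_det {m : WithTop ℕ∞} (hg : ∀ i j, ContDiff ℝ m fun x => g x i j) :
    ContDiff ℝ m fun x => (g x).det := by
  simp only [det_apply]
  exact ContDiff.sum fun σ _ => (contDiff_prod fun i _ => hg _ _).const_smul _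

theorem contDiff_matrix_inv {m : WithTop ℕ∞} (hg : ∀ i j, ContDiff ℝ m fun x => g x i j)
    (hdet : ∀ x, (g x).det ≠ 0) (i j : Fin d) : ContDiff ℝ m fun x => (g x)⁻¹ i j := by
  simp only [inv_def, Ring.inverse_eq_inv', Matrix.smul_apply, smul_eq_mul, adjugate_apply]
  refine ((contDiff_matrix_det hg).inv hdet).mul (contDiff_matrix_det fun k l => ?_)
  simp only [updateRow_apply]
  split_ifs
  · exact contDiff_const
  · exact hg k l

theorem MatCD.continuous_inv {k : ℕ} (hg : MatCD k g) (hpos : ∀ x, (g x).PosDef) :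
    Continuous fun x => (g x)⁻¹ :=
  continuous_matrix fun i j =>
    (contDiff_matrix_inv hg (fun x => (hpos x).det_pos.ne') i j).continuous

/-- The regularization `g⁻¹ (ρ * (g F))` of `F`. -/
def regularize (g : (Fin n → ℝ) → Matrix (Fin d) (Fin d) ℝ) (ρ : (Fin n → ℝ) → ℝ)
    (F : (Fin n → ℝ) → Fin d → ℝ) (x : Fin n → ℝ) : Fin d → ℝ :=
  (g x)⁻¹ *ᵥ fun i => mollify ρ (fun y => (g y *ᵥ F y) i) x

/-- The commutator `ρ * ((∂_{x_k} g) F) - (∂_{x_k} g) g⁻¹ (ρ * (g F))`. -/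
def mollifyCommutator (g : (Fin n → ℝ) → Matrix (Fin d) (Fin d) ℝ) (ρ : (Fin n → ℝ) → ℝ)
    (F : (Fin n → ℝ) → Fin d → ℝ) (k : Fin n) (x : Fin n → ℝ) : Fin d → ℝ :=
  (fun i => mollify ρ (fun y => (mpd k g y *ᵥ F y) i) x) - mpd k g x *ᵥ regularize g ρ F x

theorem locallyIntegrable_mulVec {a : (Fin n → ℝ) → Matrix (Fin d) (Fin d) ℝ}
    {F : (Fin n → ℝ) → Fin d → ℝ} (ha : Continuous a)
    (hF : ∀ i, LocallyIntegrable fun x => F x i) (i : Fin d) :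
    LocallyIntegrable fun x => (a x *ᵥ F x) i := by
  simp only [mulVec, dotProduct]
  exact locallyIntegrable_finsetSum _ fun j _ => (hF j).continuous_smul (ha.matrix_elem i j)

theorem mulVec_regularize (hpos : ∀ x, (g x).PosDef) (ρ : (Fin n → ℝ) → ℝ)
    (F : (Fin n → ℝ) → Fin d → ℝ) (x : Fin n → ℝ) :
    g x *ᵥ regularize g ρ F x = fun i => mollify ρ (fun y => (g y *ᵥ F y) i) x := by
  rw [regularize, mulVec_mulVec, mul_nonsing_inv _ (isUnit_iff_ne_zero.2 (hpos x).det_pos.ne'),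
    one_mulVec]

theorem dotProduct_mollify {ρ : (Fin n → ℝ) → ℝ} {ε : ℝ} (hρ : IsMollifier ρ ε)
    {u : (Fin n → ℝ) → Fin d → ℝ} (hu : ∀ i, LocallyIntegrable fun x => u x i)
    (v : Fin d → ℝ) (x : Fin n → ℝ) :
    (v ⬝ᵥ fun i => mollify ρ (fun y => u y i) x) = mollify ρ (fun y => v ⬝ᵥ u y) x :=
  (mollify_sum_mul hρ.contDiff.continuous hρ.hasCompactSupport hu v x).symm

/-- Uniformly on compact sets, the regularization is controlled by the mollified energy density,
and the commutator is negligible. -/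
theorem exists_regularize_bounds (hg : MatCD 2 g) (hpos : ∀ x, (g x).PosDef)
    {F : (Fin n → ℝ) → Fin d → ℝ} (hF : ∀ i, LocallyIntegrable fun x => F x i)
    (hFL2 : Integrable fun x => vnormSq (g x) (F x)) {K : Set (Fin n → ℝ)} (hK : IsCompact K)
    {δ : ℝ} (hδ : 0 < δ) :
    ∃ ε > 0, ∀ ρ, IsMollifier ρ ε → ∀ x ∈ K,
      vnormSq (g x) (regularize g ρ F x) ≤
        2 * mollify ρ (fun y => vnormSq (g y) (F y)) x ∧
      ∀ k v, |v ⬝ᵥ mollifyCommutator g ρ F k x| ≤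
        δ * (vnormSq (g x) v + mollify ρ (fun y => vnormSq (g y) (F y)) x) := by
  have hgc := hg.continuous
  have hgi := hg.continuous_inv hpos
  obtain ⟨ε₀, hε₀, h₀⟩ := exists_nonneg_near_diagonal
    (fun (x y : Fin n → ℝ) (v : Fin d → ℝ) => 2 * vnormSq (g x) v - vnormSq (g y) v)
    (by simp only [vnormSq]; fun_prop)
    (fun x y t v => by simp only [vnormSq_smul]; ring)
    (fun x v hv => by linarith [vnormSq_pos (hpos x) hv]) hK
  have hk : ∀ (σ : ℝ) (k : Fin n), ∃ ε > 0, ∀ x ∈ K, ∀ y, dist x y < ε →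
      ∀ v : (Fin d → ℝ) × (Fin d → ℝ), 0 ≤ δ * (vnormSq (g x) v.1 + vnormSq (g y) v.2) -
        σ * (v.1 ⬝ᵥ (mpd k g y *ᵥ v.2) - v.1 ⬝ᵥ ((mpd k g x * (g x)⁻¹) *ᵥ (g y *ᵥ v.2))) := by
    intro σ k
    have hm := hg.continuous_mpd k
    have hM : Continuous fun x => mpd k g x * (g x)⁻¹ := hm.matrix_mul hgi
    refine exists_nonneg_near_diagonal
      (fun (x y : Fin n → ℝ) (v : (Fin d → ℝ) × (Fin d → ℝ)) =>
        δ * (vnormSq (g x) v.1 + vnormSq (g y) v.2) -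
        σ * (v.1 ⬝ᵥ (mpd k g y *ᵥ v.2) - v.1 ⬝ᵥ ((mpd k g x * (g x)⁻¹) *ᵥ (g y *ᵥ v.2))))
      ?_ (fun x y t v => ?_) (fun x v hv => ?_) hK
    · have c1 : Continuous fun p : (Fin n → ℝ) × (Fin n → ℝ) × (Fin d → ℝ) × (Fin d → ℝ) =>
          (mpd k g p.1 * (g p.1)⁻¹) *ᵥ (g p.2.1 *ᵥ p.2.2.2) :=
        (hM.comp continuous_fst).matrix_mulVec (by fun_prop)
      simp only [vnormSq]
      fun_prop
    · simp only [Prod.smul_fst, Prod.smul_snd, vnormSq_smul, mulVec_smul, smul_dotProduct,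
        dotProduct_smul, smul_eq_mul]
      ring
    · rw [mulVec_mulVec, mul_assoc,
        nonsing_inv_mul _ (isUnit_iff_ne_zero.2 (hpos x).det_pos.ne'), mul_one, sub_self,
        mul_zero, sub_zero]
      refine mul_pos hδ ?_
      by_cases h1 : v.1 = 0
      · have h2 : v.2 ≠ 0 := fun h2 => hv (Prod.ext h1 h2)
        linarith [vnormSq_pos (hpos x) h2, vnormSq_nonneg (hpos x).posSemidef v.1]
      · linarith [vnormSq_pos (hpos x) h1, vnormSq_nonneg (hpos x).posSemidef v.2]
  choose ε₁ hε₁ h₁ using hk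
  obtain ⟨ε, hε, hle₀, hle⟩ : ∃ ε > 0, ε ≤ ε₀ ∧ ∀ k, ε ≤ ε₁ 1 k ∧ ε ≤ ε₁ (-1) k := by
    have h : ∀ᶠ ε in nhdsWithin (0 : ℝ) (Set.Ioi 0), 0 < ε ∧ ε ≤ ε₀ ∧
        ∀ k, ε ≤ ε₁ 1 k ∧ ε ≤ ε₁ (-1) k := by
      have hI : ∀ {r : ℝ}, 0 < r → ∀ᶠ ε in nhdsWithin (0 : ℝ) (Set.Ioi 0), ε ≤ r := fun hr =>
        Filter.Eventually.mono (Ioc_mem_nhdsGT hr) fun _ h => h.2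
      exact Filter.Eventually.and self_mem_nhdsWithin ((hI hε₀).and
        (Filter.eventually_all.2 fun k => (hI (hε₁ 1 k)).and (hI (hε₁ (-1) k))))
    obtain ⟨ε, h1, h2, h3⟩ := h.exists
    exact ⟨ε, h1, h2, h3⟩
  have hu := locallyIntegrable_mulVec hgc hF
  refine ⟨ε, hε, fun ρ hρ x hx => ⟨?_, fun k v => ?_⟩⟩
  · set f := regularize g ρ F x with hf
    have he : vnormSq (g x) f = mollify ρ (fun y => f ⬝ᵥ g y *ᵥ F y) x := by
      rw [vnormSq, hf, mulVec_regularize hpos, dotProduct_comm, dotProduct_mollify hρ hu]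
    have hb := hρ.abs_mollify_le hFL2.locallyIntegrable (b := fun y => f ⬝ᵥ g y *ᵥ F y)
      (α := 1 / 2 * vnormSq (g x) f) (δ := 1) (x := x) fun y hy => by
        have h1 := abs_dotProduct_mulVec_le (hpos y).posSemidef f (F y)
        have h2 := h₀ x hx y (hy.trans_le hle₀) f
        linarith
    rw [← he] at hb
    linarith [le_abs_self (vnormSq (g x) f)]
  · set M := mpd k g x * (g x)⁻¹ with hM
    have hum := locallyIntegrable_mulVec (hg.continuous_mpd k) hF
    have he : v ⬝ᵥ mollifyCommutator g ρ F k x =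
        mollify ρ (fun y => v ⬝ᵥ (mpd k g y *ᵥ F y) - v ⬝ᵥ (M *ᵥ (g y *ᵥ F y))) x := by
      have hl : ∀ {w : Fin d → ℝ} {u : (Fin n → ℝ) → Fin d → ℝ},
          (∀ i, LocallyIntegrable fun x => u x i) → LocallyIntegrable fun y => w ⬝ᵥ u y := by
        intro w u hu
        simp only [dotProduct]
        exact locallyIntegrable_finsetSum _ fun j _ => (hu j).smul (w j)
      simp only [dotProduct_mulVec v M]
      rw [mollify_sub hρ.contDiff.continuous hρ.hasCompactSupport (hl hum) (hl hu),
        ← dotProduct_mollify hρ hum, ← dotProduct_mollify hρ hu, mollifyCommutator, regularize,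
        dotProduct_sub, mulVec_mulVec, ← hM, dotProduct_mulVec v M]
    rw [he, mul_add]
    refine hρ.abs_mollify_le hFL2.locallyIntegrable fun y hy => ?_
    have h1 := h₁ 1 k x hx y (hy.trans_le (hle k).1) (v, F y)
    have h2 := h₁ (-1) k x hx y (hy.trans_le (hle k).2) (v, F y)
    simp only [← hM] at h1 h2
    rw [abs_le]
    constructor <;> linarith

end Regularization

section WeakEquation

variable {n d : ℕ} {g : (Fin n → ℝ) → Matrix (Fin d) (Fin d) ℝ}

theorem transpose_mpd (hpos : ∀ x, (g x).PosDef) (k : Fin n) (x : Fin n → ℝ) :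
    (mpd k g x)ᵀ = mpd k g x := by
  ext i j
  have h : (fun y => g y j i) = fun y => g y i j := by
    ext y
    rw [← transpose_apply (g y), transpose_eq_of_posSemidef (hpos y).posSemidef]
  simp only [transpose_apply, mpd, of_apply, h]

/-- The weighted operator tested on a scalar function times a coordinate vector. -/
theorem mulVec_dotProduct_Lop_single (hpos : ∀ x, (g x).PosDef) (ψ : (Fin n → ℝ) → ℝ)
    (u : Fin d → ℝ) (i : Fin d) (x : Fin n → ℝ) :
    (g x *ᵥ u) ⬝ᵥ Lop g (fun y => Pi.single i (ψ y)) x =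
      ∑ k, (pd k (pd k ψ) x * (g x *ᵥ u) i + pd k ψ x * (mpd k g x *ᵥ u) i) := by
  have hpd : ∀ (k : Fin n) (φ : (Fin n → ℝ) → ℝ),
      pdF k (fun y => (Pi.single i (φ y) : Fin d → ℝ)) = fun y => Pi.single i (pd k φ y) := by
    intro k φ
    ext y j
    by_cases hj : j = i
    · subst hj
      simp [pdF, pd]
    · simp [pdF, hj]
  simp only [Lop, hpd]
  rw [dotProduct_add, dotProduct_sum, dotProduct_sum, Finset.sum_add_distrib]
  congr 1
  · exact Finset.sum_congr rfl fun k _ => by rw [dotProduct_single, mul_comm]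
  · refine Finset.sum_congr rfl fun k _ => ?_
    rw [mulVec_dotProduct_comm (transpose_eq_of_posSemidef (hpos x).posSemidef), mulVec_mulVec,
      ← mul_assoc, mul_nonsing_inv _ (isUnit_iff_ne_zero.2 (hpos x).det_pos.ne'), one_mul,
      ← mulVec_dotProduct_comm (transpose_mpd hpos k x), dotProduct_single, mul_comm]

/-- The flux `∂_{x_k} (ρ * (g F)) - ρ * ((∂_{x_k} g) F)`. -/
def mollifyFlux (g : (Fin n → ℝ) → Matrix (Fin d) (Fin d) ℝ) (ρ : (Fin n → ℝ) → ℝ)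
    (F : (Fin n → ℝ) → Fin d → ℝ) (k : Fin n) (x : Fin n → ℝ) : Fin d → ℝ :=
  fun i => pd k (mollify ρ fun y => (g y *ᵥ F y) i) x - mollify ρ (fun y => (mpd k g y *ᵥ F y) i) x

variable {F : (Fin n → ℝ) → Fin d → ℝ} {ρ : (Fin n → ℝ) → ℝ} {ε : ℝ}

theorem contDiff_mollifyFlux (hg : MatCD 2 g) (hF : ∀ i, LocallyIntegrable fun x => F x i)
    (hρ : IsMollifier ρ ε) (k : Fin n) (i : Fin d) :
    ContDiff ℝ 1 fun x => mollifyFlux g ρ F k x i :=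
  (contDiff_pd k (contDiff_mollify (m := 2) (hρ.contDiff.of_le (mod_cast le_top))
    hρ.hasCompactSupport (locallyIntegrable_mulVec hg.continuous hF i)) (by norm_num)).sub
    (contDiff_mollify (m := 1) (hρ.contDiff.of_le (mod_cast le_top))
    hρ.hasCompactSupport (locallyIntegrable_mulVec (hg.continuous_mpd k) hF i))

theorem pd_comp_sub_left (k : Fin n) {φ : (Fin n → ℝ) → ℝ} (hφ : Differentiable ℝ φ)
    (x y : Fin n → ℝ) : pd k (fun y => φ (x - y)) y = -pd k φ (x - y) := by
  have h : HasFDerivAt (fun y => φ (x - y))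
      ((fderiv ℝ φ (x - y)).comp (-ContinuousLinearMap.id ℝ (Fin n → ℝ))) y :=
    HasFDerivAt.comp y (hφ (x - y)).hasFDerivAt ((hasFDerivAt_id y).const_sub x)
  simp [pd, h.fderiv]

theorem pd_neg (k : Fin n) (φ : (Fin n → ℝ) → ℝ) (x : Fin n → ℝ) :
    pd k (fun y => -φ y) x = -pd k φ x := by
  simp only [pd]
  rw [fderiv_fun_neg]
  simp

/-- If `F` is orthogonal to the range of `L`, then the mollified flux is divergence free. -/
theorem sum_pd_mollifyFlux (hg : MatCD 2 g) (hpos : ∀ x, (g x).PosDef)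
    (hF : ∀ i, LocallyIntegrable fun x => F x i)
    (hweak : ∀ Ψ : (Fin n → ℝ) → Fin d → ℝ, ContDiff ℝ 2 Ψ → HasCompactSupport Ψ →
      ∫ x, (g x *ᵥ F x) ⬝ᵥ Lop g Ψ x = 0)
    (hρ : IsMollifier ρ ε) (i : Fin d) (x : Fin n → ℝ) :
    ∑ k, pd k (fun x => mollifyFlux g ρ F k x i) x = 0 := by
  have hu := locallyIntegrable_mulVec hg.continuous hF i
  have hv := fun k => locallyIntegrable_mulVec (hg.continuous_mpd k) hF i
  have hc := hρ.hasCompactSupport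
  have hρm : ∀ m : ℕ∞, ContDiff ℝ m ρ := fun m => hρ.contDiff.of_le (mod_cast le_top)
  have hψ : ContDiff ℝ 2 fun y => ρ (x - y) := (hρm 2).comp (contDiff_const.sub contDiff_id)
  have hψc : HasCompactSupport fun y => ρ (x - y) :=
    hc.comp_homeomorph (Homeomorph.subLeft x)
  have h := hweak (fun y => Pi.single i (ρ (x - y)))
    ((ContinuousLinearMap.single ℝ (fun _ : Fin d => ℝ) i).contDiff.comp hψ)
    (hψc.comp_left (g := fun t => (Pi.single i t : Fin d → ℝ)) (by simp))
  have hρ1 : ∀ k, ContDiff ℝ 1 (pd k ρ) := fun k => contDiff_pd k (hρm 2) (by norm_num)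
  have hi1 : ∀ k, Integrable fun y => pd k (pd k ρ) (x - y) * (g y *ᵥ F y) i := fun k =>
    integrable_mollify_integrand (contDiff_pd k (hρ1 k) (l := 0) (by norm_num)).continuous
      (hasCompactSupport_pd k (hasCompactSupport_pd k hc)) hu x
  have hi2 : ∀ k, Integrable fun y => pd k ρ (x - y) * (mpd k g y *ᵥ F y) i := fun k =>
    integrable_mollify_integrand (hρ1 k).continuous (hasCompactSupport_pd k hc) (hv k) x
  have hpd : ∀ k, pd k (fun y => ρ (x - y)) = fun y => -pd k ρ (x - y) := fun k =>
    funext fun y =>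
    pd_comp_sub_left k ((hρm 1).differentiable one_ne_zero) x y
  have hpd2 : ∀ k y, pd k (fun y => pd k ρ (x - y)) y = -pd k (pd k ρ) (x - y) := fun k y =>
    pd_comp_sub_left k ((hρ1 k).differentiable one_ne_zero) x y
  simp only [mulVec_dotProduct_Lop_single hpos, hpd, pd_neg, hpd2, neg_neg,
    neg_mul, ← sub_eq_add_neg] at h
  have hi : ∀ k, Integrable fun y => pd k (pd k ρ) (x - y) * (g y *ᵥ F y) i -
      pd k ρ (x - y) * (mpd k g y *ᵥ F y) i := fun k => (hi1 k).sub (hi2 k)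
  rw [integral_finsetSum _ fun k _ => hi k] at h
  rw [← h]
  refine Finset.sum_congr rfl fun k _ => ?_
  rw [integral_sub (hi1 k) (hi2 k)]
  simp only [mollifyFlux]
  have e1 : pd k (mollify ρ fun y => (g y *ᵥ F y) i) =
      mollify (pd k ρ) fun y => (g y *ᵥ F y) i := pd_mollify k (hρm 1) hc hu
  have d1 : Differentiable ℝ (mollify (pd k ρ) fun y => (g y *ᵥ F y) i) :=
    (contDiff_mollify (m := 1) (hρ1 k) (hasCompactSupport_pd k hc) hu).differentiable one_ne_zero
  have d2 : Differentiable ℝ (mollify ρ fun y => (mpd k g y *ᵥ F y) i) :=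
    (contDiff_mollify (m := 1) (hρm 1) hc (hv k)).differentiable one_ne_zero
  rw [e1, pd_sub k (d1 x) (d2 x), pd_mollify k (hρ1 k) (hasCompactSupport_pd k hc) hu,
    pd_mollify k (hρm 1) hc (hv k)]
  rfl

theorem contDiff_regularize (hg : MatCD 2 g) (hpos : ∀ x, (g x).PosDef)
    (hF : ∀ i, LocallyIntegrable fun x => F x i) (hρ : IsMollifier ρ ε) (i : Fin d) :
    ContDiff ℝ 2 fun x => regularize g ρ F x i := by
  simp only [regularize, mulVec, dotProduct]
  refine ContDiff.sum fun j _ => ContDiff.mul ?_ ?_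
  · exact contDiff_matrix_inv hg (fun x => (hpos x).det_pos.ne') i j
  · exact contDiff_mollify (m := 2) (hρ.contDiff.of_le (mod_cast le_top))
      hρ.hasCompactSupport (locallyIntegrable_mulVec hg.continuous hF j)

theorem mollifyFlux_eq (hg : MatCD 2 g) (hpos : ∀ x, (g x).PosDef)
    (hF : ∀ i, LocallyIntegrable fun x => F x i) (hρ : IsMollifier ρ ε) (k : Fin n)
    (x : Fin n → ℝ) :
    mollifyFlux g ρ F k x =
      g x *ᵥ pdF k (regularize g ρ F) x - mollifyCommutator g ρ F k x := by
  have hd : ∀ j, DifferentiableAt ℝ (fun x => regularize g ρ F x j) x := fun j =>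
    (contDiff_regularize hg hpos hF hρ j).differentiable two_ne_zero x
  have hgd : ∀ i j, DifferentiableAt ℝ (fun x => g x i j) x := fun i j =>
    (hg i j).differentiable two_ne_zero x
  ext i
  have h : (mollify ρ fun y => (g y *ᵥ F y) i) = fun x => ∑ j, g x i j * regularize g ρ F x j := by
    ext z
    exact (congrFun (mulVec_regularize hpos ρ F z) i).symm
  simp only [mollifyFlux, mollifyCommutator, Pi.sub_apply]
  have hs : pd k (fun x => ∑ j, g x i j * regularize g ρ F x j) x =
      ∑ j, pd k (fun x => g x i j * regularize g ρ F x j) x :=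
    pd_sum k fun j => (hgd i j).mul (hd j)
  rw [h, hs]
  have e : ∀ j, pd k (fun x => g x i j * regularize g ρ F x j) x =
      mpd k g x i j * regularize g ρ F x j + g x i j * pdF k (regularize g ρ F) x j := fun j =>
    pd_mul k (hgd i j) (hd j)
  simp only [e, Finset.sum_add_distrib]
  simp only [mulVec, dotProduct]
  ring

end WeakEquation

section Caccioppoli

variable {n d : ℕ} {g : (Fin n → ℝ) → Matrix (Fin d) (Fin d) ℝ}
  {F : (Fin n → ℝ) → Fin d → ℝ} {ρ : (Fin n → ℝ) → ℝ} {ε : ℝ}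

/-- The pointwise lower bound behind the Caccioppoli inequality. -/
theorem caccioppoli_pointwise {a : Matrix (Fin d) (Fin d) ℝ} (ha : a.PosSemidef)
    {v w r : Fin d → ℝ} {H s c δ β : ℝ} (hH : 0 ≤ H) (hδ0 : 0 ≤ δ) (hδ : δ ≤ 1 / 4)
    (hs : |s| ≤ 1) (hc : |c| ≤ β) (hβ : β ≤ 1) (hw : vnormSq a w ≤ 2 * H)
    (hr : ∀ u, |u ⬝ᵥ r| ≤ δ * (vnormSq a u + H)) :
    1 / 4 * (s ^ 2 * vnormSq a v) - (7 * δ + 4 * β ^ 2) * H ≤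
      2 * s * c * (w ⬝ᵥ (a *ᵥ v - r)) + s ^ 2 * (v ⬝ᵥ (a *ᵥ v - r)) := by
  have hv0 := vnormSq_nonneg ha v
  have hw0 := vnormSq_nonneg ha w
  have h1 := vnormSq_nonneg ha ((2 * c) • w + s • v)
  rw [vnormSq_smul_add_smul (transpose_eq_of_posSemidef ha)] at h1
  have hvv : v ⬝ᵥ a *ᵥ v = vnormSq a v := dotProduct_comm _ _
  have hs2 : s ^ 2 ≤ 1 := (sq_le_one_iff_abs_le_one s).2 hs
  have hc2 : c ^ 2 ≤ β ^ 2 := sq_le_sq' (by linarith [(abs_le.1 hc).1]) (abs_le.1 hc).2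
  have hcw : c ^ 2 * vnormSq a w ≤ β ^ 2 * (2 * H) := mul_le_mul hc2 hw hw0 (sq_nonneg β)
  have hsc : |s * c| ≤ 1 := by
    rw [abs_mul]
    exact mul_le_one₀ hs (abs_nonneg c) (hc.trans hβ)
  have h2 : s * c * (w ⬝ᵥ r) ≤ δ * (3 * H) := by
    refine (le_abs_self _).trans ?_
    rw [abs_mul]
    calc |s * c| * |w ⬝ᵥ r| ≤ 1 * |w ⬝ᵥ r| := by gcongr
      _ ≤ δ * (vnormSq a w + H) := by rw [one_mul]; exact hr w
      _ ≤ δ * (3 * H) := by gcongr; linarith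
  have h3 : s ^ 2 * (v ⬝ᵥ r) ≤ 1 / 4 * (s ^ 2 * vnormSq a v) + δ * H := by
    calc s ^ 2 * (v ⬝ᵥ r) ≤ s ^ 2 * (δ * (vnormSq a v + H)) := by
          gcongr
          exact (le_abs_self _).trans (hr v)
      _ = δ * (s ^ 2 * vnormSq a v) + s ^ 2 * (δ * H) := by ring
      _ ≤ 1 / 4 * (s ^ 2 * vnormSq a v) + 1 * (δ * H) := by gcongr
      _ = _ := by ring
  rw [dotProduct_sub, dotProduct_sub, hvv]
  nlinarith

theorem pd_dotProduct (k : Fin n) {f w : (Fin n → ℝ) → Fin d → ℝ} {x : Fin n → ℝ}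
    (hf : ∀ i, DifferentiableAt ℝ (fun x => f x i) x)
    (hw : ∀ i, DifferentiableAt ℝ (fun x => w x i) x) :
    pd k (fun x => f x ⬝ᵥ w x) x = pdF k f x ⬝ᵥ w x + f x ⬝ᵥ pdF k w x := by
  simp only [dotProduct]
  rw [pd_sum k (f := fun i x => f x i * w x i) fun i => (hf i).mul (hw i),
    ← Finset.sum_add_distrib]
  exact Finset.sum_congr rfl fun i _ => pd_mul k (hf i) (hw i)

theorem caccioppoli (hg : MatCD 2 g) (hpos : ∀ x, (g x).PosDef)
    (hF : ∀ i, LocallyIntegrable fun x => F x i)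
    (hFL2 : Integrable fun x => vnormSq (g x) (F x))
    (hweak : ∀ Ψ : (Fin n → ℝ) → Fin d → ℝ, ContDiff ℝ 2 Ψ → HasCompactSupport Ψ →
      ∫ x, (g x *ᵥ F x) ⬝ᵥ Lop g Ψ x = 0)
    (hρ : IsMollifier ρ ε) {χ : (Fin n → ℝ) → ℝ} (hχ : ContDiff ℝ 2 χ)
    (hχc : HasCompactSupport χ) (hχ1 : ∀ x, |χ x| ≤ 1) {β δ : ℝ} (hδ0 : 0 ≤ δ) (hδ : δ ≤ 1 / 4)
    (hβ : β ≤ 1) (hχβ : ∀ k x, |pd k χ x| ≤ β)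
    (hb : ∀ x ∈ tsupport χ,
      vnormSq (g x) (regularize g ρ F x) ≤ 2 * mollify ρ (fun y => vnormSq (g y) (F y)) x ∧
      ∀ k v, |v ⬝ᵥ mollifyCommutator g ρ F k x| ≤
        δ * (vnormSq (g x) v + mollify ρ (fun y => vnormSq (g y) (F y)) x)) :
    ∫ x, χ x ^ 2 * ∑ k, vnormSq (g x) (pdF k (regularize g ρ F) x) ≤
      4 * (n * (7 * δ + 4 * β ^ 2)) * ∫ x, vnormSq (g x) (F x) := by
  set f := regularize g ρ F with hf
  set H := mollify ρ fun y => vnormSq (g y) (F y) with hH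
  have hfc : ∀ i, ContDiff ℝ 2 fun x => f x i := contDiff_regularize hg hpos hF hρ
  have hWc : ∀ k i, ContDiff ℝ 1 fun x => mollifyFlux g ρ F k x i :=
    contDiff_mollifyFlux hg hF hρ
  have hfd : ∀ i, Differentiable ℝ fun x => f x i := fun i => (hfc i).differentiable two_ne_zero
  have hWd : ∀ k i, Differentiable ℝ fun x => mollifyFlux g ρ F k x i := fun k i =>
    (hWc k i).differentiable one_ne_zero
  have hχd : Differentiable ℝ χ := hχ.differentiable two_ne_zero
  have hHi : Integrable H := hρ.integrable_mollify hFL2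
  have hH0 : ∀ x, 0 ≤ H x := hρ.mollify_nonneg fun x => vnormSq_nonneg (hpos x).posSemidef _
  let T : Fin n → (Fin n → ℝ) → ℝ := fun k x => χ x * χ x * (f x ⬝ᵥ mollifyFlux g ρ F k x)
  have hdotc : ∀ k, ContDiff ℝ 1 fun x => f x ⬝ᵥ mollifyFlux g ρ F k x := fun k =>
    ContDiff.sum fun i _ => ((hfc i).of_le one_le_two).mul (hWc k i)
  have hTc : ∀ k, ContDiff ℝ 1 (T k) := fun k =>
    ((hχ.of_le one_le_two).mul (hχ.of_le one_le_two)).mul (hdotc k)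
  have hTs : ∀ k, HasCompactSupport (T k) := fun k => (hχc.mul_left).mul_right
  have hTi : ∀ k, Integrable (pd k (T k)) := fun k =>
    (contDiff_pd k (hTc k) (l := 0) (by simp)).continuous.integrable_of_hasCompactSupport
      (hasCompactSupport_pd k (hTs k))
  have hint : ∫ x, ∑ k, pd k (T k) x = 0 := by
    rw [integral_finsetSum _ fun k _ => hTi k]
    exact Finset.sum_eq_zero fun k _ => integral_pd_eq_zero k (hTc k) (hTs k)
  have hTe : ∀ x, ∑ k, pd k (T k) x =
      ∑ k, (2 * χ x * pd k χ x * (f x ⬝ᵥ mollifyFlux g ρ F k x) +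
        χ x ^ 2 * (pdF k f x ⬝ᵥ mollifyFlux g ρ F k x)) := by
    intro x
    have hdiv : ∑ k, f x ⬝ᵥ pdF k (mollifyFlux g ρ F k) x = 0 := by
      simp only [dotProduct]
      rw [Finset.sum_comm]
      refine Finset.sum_eq_zero fun i _ => ?_
      rw [← Finset.mul_sum]
      exact mul_eq_zero_of_right _ (sum_pd_mollifyFlux hg hpos hF hweak hρ i x)
    have e : ∀ k, pd k (T k) x = (2 * χ x * pd k χ x * (f x ⬝ᵥ mollifyFlux g ρ F k x) +
        χ x ^ 2 * (pdF k f x ⬝ᵥ mollifyFlux g ρ F k x)) +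
        χ x ^ 2 * (f x ⬝ᵥ pdF k (mollifyFlux g ρ F k) x) := by
      intro k
      rw [pd_mul k (f := fun x => χ x * χ x) ((hχd x).mul (hχd x))
        ((hdotc k).differentiable one_ne_zero x), pd_mul k (hχd x) (hχd x),
        pd_dotProduct k (fun i => hfd i x) (fun i => hWd k i x)]
      ring
    simp only [e]
    rw [Finset.sum_add_distrib, ← Finset.mul_sum, hdiv, mul_zero, add_zero]
  have hle : ∀ x, 1 / 4 * (χ x ^ 2 * ∑ k, vnormSq (g x) (pdF k f x)) -
      n * (7 * δ + 4 * β ^ 2) * H x ≤ ∑ k, pd k (T k) x := by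
    intro x
    have hcard : 1 / 4 * (χ x ^ 2 * ∑ k, vnormSq (g x) (pdF k f x)) -
        n * (7 * δ + 4 * β ^ 2) * H x =
        ∑ k : Fin n, (1 / 4 * (χ x ^ 2 * vnormSq (g x) (pdF k f x)) -
          (7 * δ + 4 * β ^ 2) * H x) := by
      rw [Finset.sum_sub_distrib, Finset.mul_sum, Finset.mul_sum]
      simp [mul_assoc]
    rw [hTe, hcard]
    refine Finset.sum_le_sum fun k _ => ?_
    rcases eq_or_ne (χ x) 0 with h0 | h0
    · simp only [h0]
      have : 0 ≤ (7 * δ + 4 * β ^ 2) * H x := mul_nonneg (by positivity) (hH0 x)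
      linarith
    · obtain ⟨h1, h2⟩ := hb x (subset_tsupport χ h0)
      rw [mollifyFlux_eq hg hpos hF hρ]
      exact caccioppoli_pointwise (hpos x).posSemidef (hH0 x) hδ0 hδ (hχ1 x) (hχβ k x) hβ h1 (h2 k)
  have hqc : Continuous fun x => ∑ k, vnormSq (g x) (pdF k f x) := by
    have hgc := hg.continuous
    have hp : ∀ k, Continuous (pdF k f) := fun k => continuous_pi fun i =>
      (contDiff_pd k (hfc i) (l := 0) (by norm_num)).continuous
    simp only [vnormSq]
    fun_prop
  have hqi : Integrable fun x => χ x ^ 2 * ∑ k, vnormSq (g x) (pdF k f x) := by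
    refine ((hχ.continuous.pow 2).mul hqc).integrable_of_hasCompactSupport ?_
    simp only [pow_two]
    exact (hχc.mul_left).mul_right
  have h := integral_mono ((hqi.const_mul (1 / 4)).sub (hHi.const_mul (n * (7 * δ + 4 * β ^ 2))))
    (integrable_finsetSum _ fun k _ => hTi k) hle
  rw [hint, integral_sub' (hqi.const_mul _) (hHi.const_mul _), integral_const_mul,
    integral_const_mul, hH, hρ.integral_mollify hFL2] at h
  linarith

end Caccioppoli

section Constancy

variable {n d : ℕ} {g : (Fin n → ℝ) → Matrix (Fin d) (Fin d) ℝ} {F : (Fin n → ℝ) → Fin d → ℝ}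

theorem IsMollifier.mono {ρ : (Fin n → ℝ) → ℝ} {ε ε' : ℝ} (hρ : IsMollifier ρ ε)
    (h : ε ≤ ε') : IsMollifier ρ ε' :=
  { hρ with eq_zero_of_le := fun z hz => hρ.eq_zero_of_le z (h.trans hz) }

theorem isMollifier_normed (φ : ContDiffBump (0 : Fin n → ℝ)) :
    IsMollifier (φ.normed volume) φ.rOut where
  contDiff := φ.contDiff_normed
  hasCompactSupport := φ.hasCompactSupport_normed
  nonneg := φ.nonneg_normed
  integral_eq_one := φ.integral_normed
  eq_zero_of_le z hz := by
    rw [← Function.notMem_support, φ.support_normed_eq, Metric.mem_ball, dist_zero_right]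
    exact not_lt.2 hz

theorem exists_cutoff (n : ℕ) (R : ℝ) {β : ℝ} (hβ : 0 < β) :
    ∃ χ : (Fin n → ℝ) → ℝ, ContDiff ℝ 2 χ ∧ HasCompactSupport χ ∧ (∀ x, |χ x| ≤ 1) ∧
      (∀ k x, |pd k χ x| ≤ β) ∧ ∀ x ∈ Metric.closedBall 0 R, χ x = 1 := by
  let b : ContDiffBump (0 : Fin n → ℝ) := ⟨1, 2, one_pos, one_lt_two⟩
  have hb : ContDiff ℝ 2 (b : (Fin n → ℝ) → ℝ) := b.contDiff
  have hC : ∀ k, ∃ C, ∀ x, ‖pd k b x‖ ≤ C := fun k =>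
    (hasCompactSupport_pd k b.hasCompactSupport).exists_bound_of_continuous
      (contDiff_pd k hb (l := 0) (by norm_num)).continuous
  choose C hC using hC
  obtain ⟨r, hr0, hrR, hrC⟩ : ∃ r : ℝ, 0 < r ∧ r * R ≤ 1 ∧ ∀ k, r * C k ≤ β := by
    have hI : ∀ {a c : ℝ}, 0 < c → ∀ᶠ r in nhdsWithin (0 : ℝ) (Set.Ioi 0), r * a ≤ c := by
      intro a c hc
      have h : Filter.Tendsto (fun r : ℝ => r * a) (nhdsWithin 0 (Set.Ioi 0)) (nhds (0 * a)) :=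
        ((continuous_id.mul continuous_const).tendsto 0).mono_left nhdsWithin_le_nhds
      rw [zero_mul] at h
      exact (h.eventually_lt_const hc).mono fun _ h => h.le
    have h : ∀ᶠ r in nhdsWithin (0 : ℝ) (Set.Ioi 0), 0 < r ∧ r * R ≤ 1 ∧ ∀ k, r * C k ≤ β :=
      Filter.Eventually.and self_mem_nhdsWithin ((hI one_pos).and
        (Filter.eventually_all.2 fun k => hI hβ))
    exact h.exists
  refine ⟨fun x => b (r • x), hb.comp (contDiff_const_smul r),
    b.hasCompactSupport.comp_homeomorph (Homeomorph.smulOfNeZero r hr0.ne'), fun x => ?_,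
    fun k x => ?_, fun x hx => ?_⟩
  · rw [abs_of_nonneg b.nonneg]
    exact b.le_one
  · rw [pd, fderiv_comp_smul, _root_.smul_apply, smul_eq_mul, abs_mul,
      abs_of_pos hr0]
    exact (mul_le_mul_of_nonneg_left (hC k _) hr0.le).trans (hrC k)
  · refine b.one_of_mem_closedBall ?_
    rw [mem_closedBall_zero_iff] at hx ⊢
    rw [norm_smul, Real.norm_of_nonneg hr0.le]
    exact (mul_le_mul_of_nonneg_left hx hr0.le).trans hrR

theorem exists_pos_mul_le_vnormSq (hg : Continuous g) (hpos : ∀ x, (g x).PosDef)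
    {K : Set (Fin n → ℝ)} (hK : IsCompact K) :
    ∃ c > 0, ∀ x ∈ K, ∀ v i, c * v i ^ 2 ≤ vnormSq (g x) v := by
  obtain ⟨c, hc, h⟩ := (hK.prod (isCompact_sphere (0 : Fin d → ℝ) 1)).exists_forall_le'
    (f := fun p => vnormSq (g p.1) p.2) (a := 0)
    (by simp only [vnormSq]; fun_prop)
    (fun p hp => vnormSq_pos (hpos p.1) (ne_zero_of_mem_unit_sphere ⟨p.2, hp.2⟩))
  refine ⟨c, hc, fun x hx v i => ?_⟩
  rcases eq_or_ne v 0 with rfl | hv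
  · simpa using vnormSq_nonneg (hpos x).posSemidef 0
  · have hn : 0 < ‖v‖ := norm_pos_iff.2 hv
    have h1 := h (x, ‖v‖⁻¹ • v) ⟨hx, by
      rw [mem_sphere_zero_iff_norm, norm_smul, norm_inv, norm_norm, inv_mul_cancel₀ hn.ne']⟩
    simp only [vnormSq_smul, inv_pow] at h1
    rw [inv_mul_eq_div, le_div_iff₀ (by positivity)] at h1
    refine le_trans (mul_le_mul_of_nonneg_left ?_ hc.le) h1
    rw [← sq_abs]
    exact pow_le_pow_left₀ (abs_nonneg _) (norm_le_pi_norm v i) 2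

theorem locallyIntegrable_of_integrable_vnormSq (hg : Continuous g) (hpos : ∀ x, (g x).PosDef)
    (hFm : Measurable F) (hFL2 : Integrable fun x => vnormSq (g x) (F x)) (i : Fin d) :
    LocallyIntegrable fun x => F x i := by
  rw [locallyIntegrable_iff]
  intro K hK
  obtain ⟨c, hc, h⟩ := exists_pos_mul_le_vnormSq hg hpos hK
  have hi : IntegrableOn (fun x => 1 + c⁻¹ * vnormSq (g x) (F x)) K :=
    (integrableOn_const hK.measure_lt_top.ne).add (hFL2.integrableOn.const_mul _)
  refine Integrable.mono' hi ((measurable_pi_apply i).comp hFm).aestronglyMeasurable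
    ((ae_restrict_mem hK.measurableSet).mono fun x hx => ?_)
  have h1 := h x hx (F x) i
  have h2 : F x i ^ 2 ≤ c⁻¹ * vnormSq (g x) (F x) := by
    rw [inv_mul_eq_div, le_div_iff₀ hc]
    linarith
  rw [Real.norm_eq_abs]
  nlinarith [sq_abs (F x i), sq_nonneg (|F x i| - 1)]

theorem ae_tendsto_regularize (hg : Continuous g) (hpos : ∀ x, (g x).PosDef)
    (hF : ∀ i, LocallyIntegrable fun x => F x i) {φ : ℕ → ContDiffBump (0 : Fin n → ℝ)}
    (hφ : Filter.Tendsto (fun m => (φ m).rOut) Filter.atTop (nhds 0))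
    (hφ2 : ∀ m, (φ m).rOut ≤ 2 * (φ m).rIn) :
    ∀ᵐ x, ∀ i, Filter.Tendsto (fun m => regularize g ((φ m).normed volume) F x i)
      Filter.atTop (nhds (F x i)) := by
  have h : ∀ᵐ x, ∀ i, Filter.Tendsto
      (fun m => mollify ((φ m).normed volume) (fun y => (g y *ᵥ F y) i) x)
      Filter.atTop (nhds ((g x *ᵥ F x) i)) := by
    refine ae_all_iff.2 fun i => ?_
    simp only [mollify_eq_convolution]
    exact ContDiffBump.ae_convolution_tendsto_right_of_locallyIntegrable hφ
      (Filter.Eventually.of_forall hφ2) (locallyIntegrable_mulVec hg hF i)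
  filter_upwards [h] with x hx i
  have hFx : F x = (g x)⁻¹ *ᵥ (g x *ᵥ F x) := by
    rw [mulVec_mulVec, nonsing_inv_mul _ (isUnit_iff_ne_zero.2 (hpos x).det_pos.ne'), one_mulVec]
  rw [hFx]
  exact tendsto_finsetSum Finset.univ fun j _ => (hx j).const_mul ((g x)⁻¹ i j)

/-- A field of finite energy which is orthogonal to the range of `L` is constant. -/
theorem ae_const_of_orthogonal_range (hg : MatCD 2 g) (hpos : ∀ x, (g x).PosDef)
    (hFm : Measurable F) (hFL2 : Integrable fun x => vnormSq (g x) (F x))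
    (hweak : ∀ Ψ : (Fin n → ℝ) → Fin d → ℝ, ContDiff ℝ 2 Ψ → HasCompactSupport Ψ →
      ∫ x, (g x *ᵥ F x) ⬝ᵥ Lop g Ψ x = 0) :
    ∃ c : Fin d → ℝ, ∀ᵐ x, F x = c := by
  have hgc := hg.continuous
  have hF := locallyIntegrable_of_integrable_vnormSq hgc hpos hFm hFL2
  let τ : ℕ → ℝ := fun m => 1 / ((m : ℝ) + 1)
  have hτ0 : ∀ m, 0 < τ m := fun m => Nat.one_div_pos_of_nat
  have hτ1 : ∀ m, τ m ≤ 1 := fun m => by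
    simpa [τ] using Nat.one_div_le_one_div (α := ℝ) (Nat.zero_le m)
  have hτ : Filter.Tendsto τ Filter.atTop (nhds 0) := tendsto_one_div_add_atTop_nhds_zero_nat
  choose χ hχ hχc hχ1 hχβ hχe using fun m : ℕ => exists_cutoff n m (hτ0 m)
  choose ε hε hb using fun m => exists_regularize_bounds hg hpos hF hFL2 (hχc m).isCompact
    (mul_pos (by norm_num : (0 : ℝ) < 1 / 4) (hτ0 m))
  have hr : ∀ m, 0 < min (ε m) (τ m) := fun m => lt_min (hε m) (hτ0 m)
  let φ : ℕ → ContDiffBump (0 : Fin n → ℝ) := fun m =>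
    ⟨min (ε m) (τ m) / 2, min (ε m) (τ m), half_pos (hr m), half_lt_self (hr m)⟩
  have hφ : Filter.Tendsto (fun m => (φ m).rOut) Filter.atTop (nhds 0) :=
    squeeze_zero (fun m => (hr m).le) (fun m => min_le_right _ _) hτ
  have hφ2 : ∀ m, (φ m).rOut ≤ 2 * (φ m).rIn := fun m => by
    simp only [φ]
    linarith
  let f : ℕ → (Fin n → ℝ) → Fin d → ℝ := fun m => regularize g ((φ m).normed volume) F
  have hρ : ∀ m, IsMollifier ((φ m).normed volume) (ε m) := fun m =>
    (isMollifier_normed (φ m)).mono (min_le_left _ _)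
  have hfc : ∀ m i, ContDiff ℝ 2 fun x => f m x i := fun m i =>
    contDiff_regularize hg hpos hF (hρ m) i
  have hcac : ∀ m, ∫ x, χ m x ^ 2 * ∑ k, vnormSq (g x) (pdF k (f m) x) ≤
      4 * (n * (7 * (1 / 4 * τ m) + 4 * τ m ^ 2)) * ∫ x, vnormSq (g x) (F x) := fun m =>
    caccioppoli hg hpos hF hFL2 hweak (hρ m) (hχ m) (hχc m) (hχ1 m)
      (mul_nonneg (by norm_num) (hτ0 m).le) (by linarith [hτ1 m]) (hτ1 m) (hχβ m)
      (hb m _ (hρ m))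
  have hB : Filter.Tendsto (fun m => 4 * (n * (7 * (1 / 4 * τ m) + 4 * τ m ^ 2)) *
      ∫ x, vnormSq (g x) (F x)) Filter.atTop (nhds 0) := by
    have h : Continuous fun t : ℝ => 4 * (n * (7 * (1 / 4 * t) + 4 * t ^ 2)) *
      ∫ x, vnormSq (g x) (F x) := by fun_prop
    simpa [Function.comp_def] using (h.tendsto 0).comp hτ
  have hlim := ae_tendsto_regularize hgc hpos hF hφ hφ2
  have hconst : ∀ i, ∃ c, ∀ᵐ x, F x i = c := by
    intro i
    refine ae_const_of_tendsto_of_gradient (f := fun m x => f m x i)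
      (fun m => (hfc m i).of_le one_le_two) ((measurable_pi_apply i).comp hFm)
      (hlim.mono fun x hx => hx i) fun R k => ?_
    obtain ⟨c, hc, hcv⟩ := exists_pos_mul_le_vnormSq hgc hpos
      (isCompact_closedBall (0 : Fin n → ℝ) R)
    have hB' := hB.const_mul c⁻¹
    rw [mul_zero] at hB'
    refine squeeze_zero' (Filter.Eventually.of_forall fun m =>
      integral_nonneg fun x => sq_nonneg _) ?_ hB'
    filter_upwards [Filter.eventually_ge_atTop ⌈R⌉₊] with m hm
    refine le_trans ?_ (mul_le_mul_of_nonneg_left (hcac m) (inv_nonneg.2 hc.le))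
    have hpc : ∀ k i, Continuous fun x => pdF k (f m) x i := fun k i =>
      (contDiff_pd k (hfc m i) (l := 0) (by norm_num)).continuous
    have hpc' : ∀ k, Continuous (pdF k (f m)) := fun k => continuous_pi (hpc k)
    have hqi : Integrable fun x => χ m x ^ 2 * ∑ k, vnormSq (g x) (pdF k (f m) x) := by
      refine Continuous.integrable_of_hasCompactSupport ?_ ?_
      · have := (hχ m).continuous
        simp only [vnormSq]
        fun_prop
      · simp only [pow_two]
        exact ((hχc m).mul_left).mul_right
    have hnn : ∀ x k, 0 ≤ vnormSq (g x) (pdF k (f m) x) := fun x k =>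
      vnormSq_nonneg (hpos x).posSemidef _
    calc ∫ x in Metric.closedBall 0 R, (fderiv ℝ (fun x => f m x i) x (Pi.single k 1)) ^ 2
        ≤ ∫ x in Metric.closedBall 0 R,
          c⁻¹ * (χ m x ^ 2 * ∑ k, vnormSq (g x) (pdF k (f m) x)) := by
          refine setIntegral_mono_on
            (((hpc k i).pow 2).continuousOn.integrableOn_compact (isCompact_closedBall 0 R))
            (hqi.const_mul _).integrableOn measurableSet_closedBall fun x hx => ?_
          have hx' : x ∈ Metric.closedBall 0 (m : ℝ) :=
            Metric.closedBall_subset_closedBall (Nat.ceil_le.1 hm) hx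
          rw [hχe m x hx', one_pow, one_mul, inv_mul_eq_div, le_div_iff₀ hc, mul_comm]
          exact (hcv x hx (pdF k (f m) x) i).trans
            (Finset.single_le_sum (fun k _ => hnn x k) (Finset.mem_univ k))
      _ ≤ ∫ x, c⁻¹ * (χ m x ^ 2 * ∑ k, vnormSq (g x) (pdF k (f m) x)) :=
          setIntegral_le_integral (hqi.const_mul _) (Filter.Eventually.of_forall fun x =>
            mul_nonneg (inv_nonneg.2 hc.le)
              (mul_nonneg (sq_nonneg _) (Finset.sum_nonneg fun k _ => hnn x k)))
      _ = _ := integral_const_mul _ _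
  choose c hc using hconst
  exact ⟨c, (ae_all_iff.2 hc).mono fun x hx => funext hx⟩

end Constancy

section RangeOfL

variable {n d : ℕ} {g : (Fin n → ℝ) → Matrix (Fin d) (Fin d) ℝ}

theorem pdF_eventuallyEq_zero (k : Fin n) {Ψ : (Fin n → ℝ) → Fin d → ℝ} {x : Fin n → ℝ}
    (h : Ψ =ᶠ[nhds x] 0) : pdF k Ψ =ᶠ[nhds x] 0 := by
  filter_upwards [h.eventuallyEq_nhds] with y hy
  ext i
  have hi : (fun z => Ψ z i) =ᶠ[nhds y] fun _ => 0 := hy.mono fun z hz => congrFun hz i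
  simp [pdF, hi.fderiv_eq]

theorem hasCompactSupport_Lop {Ψ : (Fin n → ℝ) → Fin d → ℝ} (hΨ : HasCompactSupport Ψ) :
    HasCompactSupport (Lop g Ψ) := by
  refine HasCompactSupport.intro hΨ.isCompact fun x hx => ?_
  have h := notMem_tsupport_iff_eventuallyEq.1 hx
  have h1 := fun k => (pdF_eventuallyEq_zero k h).eq_of_nhds
  have h2 := fun k => (pdF_eventuallyEq_zero k (pdF_eventuallyEq_zero k h)).eq_of_nhds
  simp [Lop, h1, h2]

theorem contDiff_pdF (k : Fin n) {Ψ : (Fin n → ℝ) → Fin d → ℝ} {m l : WithTop ℕ∞}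
    (hΨ : ContDiff ℝ m Ψ) (h : l + 1 ≤ m) : ContDiff ℝ l (pdF k Ψ) :=
  contDiff_pi.2 fun i => contDiff_pd k (contDiff_pi.1 hΨ i) h

theorem continuous_Lop (hg : MatCD 2 g) (hpos : ∀ x, (g x).PosDef)
    {Ψ : (Fin n → ℝ) → Fin d → ℝ} (hΨ : ContDiff ℝ 2 Ψ) : Continuous (Lop g Ψ) := by
  have h1 : ∀ k, ContDiff ℝ 1 (pdF k Ψ) := fun k => contDiff_pdF k hΨ (by norm_num)
  have h2 : ∀ k, Continuous (pdF k (pdF k Ψ)) := fun k =>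
    (contDiff_pdF k (h1 k) (l := 0) (by norm_num)).continuous
  have h3 : ∀ k, Continuous fun x => ((g x)⁻¹ * mpd k g x) *ᵥ pdF k Ψ x := fun k =>
    ((hg.continuous_inv hpos).matrix_mul (hg.continuous_mpd k)).matrix_mulVec (h1 k).continuous
  unfold Lop
  fun_prop

theorem pdF_add (k : Fin n) {Φ Ψ : (Fin n → ℝ) → Fin d → ℝ} (hΦ : Differentiable ℝ Φ)
    (hΨ : Differentiable ℝ Ψ) : pdF k (Φ + Ψ) = pdF k Φ + pdF k Ψ := by
  ext x i
  simp only [pdF, Pi.add_apply]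
  rw [fderiv_fun_add (differentiable_pi.1 hΦ i x) (differentiable_pi.1 hΨ i x)]
  rfl

theorem pdF_smul (k : Fin n) (t : ℝ) {Ψ : (Fin n → ℝ) → Fin d → ℝ} (hΨ : Differentiable ℝ Ψ) :
    pdF k (t • Ψ) = t • pdF k Ψ := by
  ext x i
  simp only [pdF, Pi.smul_apply]
  rw [fderiv_fun_const_smul (differentiable_pi.1 hΨ i x)]
  rfl

theorem Lop_add {Φ Ψ : (Fin n → ℝ) → Fin d → ℝ} (hΦ : ContDiff ℝ 2 Φ) (hΨ : ContDiff ℝ 2 Ψ) :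
    Lop g (Φ + Ψ) = Lop g Φ + Lop g Ψ := by
  have h1 := fun k => pdF_add k (hΦ.differentiable two_ne_zero) (hΨ.differentiable two_ne_zero)
  have h2 := fun k => pdF_add k
    ((contDiff_pdF k hΦ (l := 1) (by norm_num)).differentiable one_ne_zero)
    ((contDiff_pdF k hΨ (l := 1) (by norm_num)).differentiable one_ne_zero)
  ext1 x
  simp only [Lop, h1, h2, Pi.add_apply, mulVec_add, Finset.sum_add_distrib]
  abel

theorem Lop_smul (t : ℝ) {Ψ : (Fin n → ℝ) → Fin d → ℝ} (hΨ : ContDiff ℝ 2 Ψ) :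
    Lop g (t • Ψ) = t • Lop g Ψ := by
  have h1 := fun k => pdF_smul k t (hΨ.differentiable two_ne_zero)
  have h2 := fun k => pdF_smul k t
    ((contDiff_pdF k hΨ (l := 1) (by norm_num)).differentiable one_ne_zero)
  ext1 x
  simp only [Lop, h1, h2, Pi.smul_apply, mulVec_smul, smul_add, Finset.smul_sum]

theorem measurable_mulVec {X ι κ : Type*} [MeasurableSpace X] [Fintype κ]
    {a : X → Matrix ι κ ℝ} {u : X → κ → ℝ} (ha : ∀ i j, Measurable fun x => a x i j)
    (hu : Measurable u) : Measurable fun x => a x *ᵥ u x :=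
  measurable_pi_lambda _ fun i => Finset.measurable_fun_sum _ fun j _ =>
    (ha i j).mul ((measurable_pi_apply j).comp hu)

theorem integrable_mulVec_of_integrable_vnormSq (hpos : ∀ x, (g x).PosDef)
    (hgint : ∀ i k, Integrable fun x => g x i k) {F : (Fin n → ℝ) → Fin d → ℝ}
    (hFm : Measurable F) (hFL2 : Integrable fun x => vnormSq (g x) (F x)) (i : Fin d) :
    Integrable fun x => (g x *ᵥ F x) i := by
  have hgc : AEStronglyMeasurable (fun x => (g x *ᵥ F x) i) := by
    simp only [mulVec, dotProduct]
    exact Finset.aestronglyMeasurable_fun_sum _ fun j _ => (hgint i j).aestronglyMeasurable.mul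
      ((measurable_pi_apply j).comp hFm).aestronglyMeasurable
  refine Integrable.mono' (((hgint i i).const_mul (1 / 4)).add hFL2) hgc
    (Filter.Eventually.of_forall fun x => ?_)
  have h := abs_dotProduct_mulVec_le (hpos x).posSemidef (Pi.single i 1) (F x)
  simpa [vnormSq, single_dotProduct] using h

end RangeOfL

/-- The `L²` class of `S LΨ` for test fields `Ψ`. -/
def rangeSubmodule {n d : ℕ} (g S : (Fin n → ℝ) → Matrix (Fin d) (Fin d) ℝ) :
    Submodule ℝ (Lp (EuclideanSpace ℝ (Fin d)) 2 (volume : Measure (Fin n → ℝ))) where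
  carrier := {Φ | ∃ Ψ : (Fin n → ℝ) → Fin d → ℝ, ContDiff ℝ 2 Ψ ∧ HasCompactSupport Ψ ∧
    Φ =ᵐ[volume] fun x => WithLp.toLp 2 (S x *ᵥ Lop g Ψ x)}
  zero_mem' := by
    refine ⟨0, contDiff_const, HasCompactSupport.zero, ?_⟩
    have h : Lop g (0 : (Fin n → ℝ) → Fin d → ℝ) = 0 := by
      simpa using Lop_smul (g := g) 0 (contDiff_const (c := (0 : Fin d → ℝ)))
    filter_upwards [Lp.coeFn_zero (EuclideanSpace ℝ (Fin d)) 2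
      (volume : Measure (Fin n → ℝ))] with x hx
    rw [hx, h]
    simp
  add_mem' := by
    rintro Φ₁ Φ₂ ⟨Ψ₁, h₁, hc₁, he₁⟩ ⟨Ψ₂, h₂, hc₂, he₂⟩
    refine ⟨Ψ₁ + Ψ₂, h₁.add h₂, hc₁.add hc₂, ?_⟩
    filter_upwards [Lp.coeFn_add Φ₁ Φ₂, he₁, he₂] with x hx hx₁ hx₂
    rw [hx, Pi.add_apply, hx₁, hx₂, Lop_add h₁ h₂, Pi.add_apply, mulVec_add, WithLp.toLp_add]
  smul_mem' := by
    rintro t Φ ⟨Ψ, h, hc, he⟩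
    refine ⟨t • Ψ, h.const_smul t, hc.smul_left (f := fun _ => t), ?_⟩
    filter_upwards [Lp.coeFn_smul t Φ, he] with x hx hx'
    rw [hx, Pi.smul_apply, hx', Lop_smul t h, Pi.smul_apply, mulVec_smul, WithLp.toLp_smul]

section SquareRoot

variable {n d : ℕ} {g S : (Fin n → ℝ) → Matrix (Fin d) (Fin d) ℝ}

theorem vnormSq_eq_norm_sq {a s : Matrix (Fin d) (Fin d) ℝ} (hs : sᵀ = s) (hsa : s * s = a)
    (u : Fin d → ℝ) : vnormSq a u = ‖WithLp.toLp 2 (s *ᵥ u)‖ ^ 2 := by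
  rw [← real_inner_self_eq_norm_sq, EuclideanSpace.inner_toLp_toLp, star_trivial, vnormSq, ← hsa,
    ← mulVec_mulVec, mulVec_dotProduct_comm hs]

theorem memLp_sqrt_mulVec (hSm : ∀ i j, Measurable fun x => S x i j) (hSt : ∀ x, (S x)ᵀ = S x)
    (hS : ∀ x, S x * S x = g x) {u : (Fin n → ℝ) → Fin d → ℝ} (hu : Measurable u)
    (hi : Integrable fun x => vnormSq (g x) (u x)) :
    MemLp (fun x => WithLp.toLp 2 (S x *ᵥ u x)) 2 (volume : Measure (Fin n → ℝ)) := by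
  have hm : Measurable fun x => WithLp.toLp 2 (S x *ᵥ u x) :=
    (WithLp.measurable_toLp 2 _).comp (measurable_mulVec hSm hu)
  rw [memLp_two_iff_integrable_sq_norm hm.aestronglyMeasurable]
  simpa only [← vnormSq_eq_norm_sq (hSt _) (hS _)] using hi

theorem orthogonal_rangeSubmodule (hg : MatCD 2 g) (hpos : ∀ x, (g x).PosDef)
    (hSm : ∀ i j, Measurable fun x => S x i j) (hSt : ∀ x, (S x)ᵀ = S x)
    (hS : ∀ x, S x * S x = g x)
    {G : Lp (EuclideanSpace ℝ (Fin d)) 2 (volume : Measure (Fin n → ℝ))}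
    (hG : G ∈ (rangeSubmodule g S)ᗮ) :
    ∃ c : Fin d → ℝ, ∀ᵐ x, S x *ᵥ (G x).ofLp = g x *ᵥ c := by
  have hu : ∀ x, IsUnit (g x).det := fun x => isUnit_iff_ne_zero.2 (hpos x).det_pos.ne'
  have hGm : Measurable fun x => (G x).ofLp :=
    (WithLp.measurable_ofLp 2 _).comp (Lp.stronglyMeasurable G).measurable
  let F : (Fin n → ℝ) → Fin d → ℝ := fun x => (g x)⁻¹ *ᵥ (S x *ᵥ (G x).ofLp)
  have hFm : Measurable F := measurable_mulVec
    (fun i j => ((hg.continuous_inv hpos).matrix_elem i j).measurable) (measurable_mulVec hSm hGm)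
  have hgF : ∀ x, g x *ᵥ F x = S x *ᵥ (G x).ofLp := fun x => by
    rw [mulVec_mulVec, mul_nonsing_inv _ (hu x), one_mulVec]
  have hSF : ∀ x, S x *ᵥ F x = (G x).ofLp := fun x => by
    have h : (g x)⁻¹ * S x * S x = 1 := by rw [mul_assoc, hS, nonsing_inv_mul _ (hu x)]
    rw [mulVec_mulVec, mulVec_mulVec, mul_assoc, mul_eq_one_comm.1 h, one_mulVec]
  have hFL2 : Integrable fun x => vnormSq (g x) (F x) := by
    simp only [vnormSq_eq_norm_sq (hSt _) (hS _), hSF]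
    exact (memLp_two_iff_integrable_sq_norm (Lp.aestronglyMeasurable G)).1 (Lp.memLp G)
  obtain ⟨c, hc⟩ := ae_const_of_orthogonal_range hg hpos hFm hFL2 fun Ψ hΨ hΨc => by
    have hLc := continuous_Lop hg hpos hΨ
    have hLs := hasCompactSupport_Lop (g := g) hΨc
    have hgc := hg.continuous
    have hLi : Integrable fun x => vnormSq (g x) (Lop g Ψ x) := by
      refine Continuous.integrable_of_hasCompactSupport ?_ ?_
      · simp only [vnormSq]
        fun_prop
      · refine HasCompactSupport.intro hLs.isCompact fun x hx => ?_
        simp [vnormSq, image_eq_zero_of_notMem_tsupport hx]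
    have hL := memLp_sqrt_mulVec hSm hSt hS hLc.measurable hLi
    have h := (Submodule.mem_orthogonal _ _).1 hG (hL.toLp _) ⟨Ψ, hΨ, hΨc, hL.coeFn_toLp⟩
    rw [L2.inner_def] at h
    rw [← h]
    refine integral_congr_ae ?_
    filter_upwards [hL.coeFn_toLp] with x hx
    rw [hx, hgF, mulVec_dotProduct_comm (hSt x), EuclideanSpace.inner_eq_star_dotProduct,
      star_trivial]
  exact ⟨c, hc.mono fun x hx => by rw [← hgF, hx]⟩

end SquareRoot

/-- **Density of the range of `L`**: the set `{LΨ : Ψ C², compactly supported}` is dense,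
in `L²(g)`, in the set of `F ∈ L²(g)` with `∫ g F = 0`. -/
theorem range_L_dense (n d : ℕ)
    (g : (Fin n → ℝ) → Matrix (Fin d) (Fin d) ℝ)
    (hg : MatCD 2 g) (hgpos : ∀ x, (g x).PosDef)
    (hgint : ∀ i k, Integrable fun x : Fin n → ℝ => g x i k)
    (F : (Fin n → ℝ) → Fin d → ℝ) (hFm : Measurable F)
    (hFL2 : Integrable fun x : Fin n → ℝ => vnormSq (g x) (F x))
    (hFmean : (∫ x : Fin n → ℝ, (g x).mulVec (F x)) = 0) :
    ∀ ε > (0 : ℝ), ∃ Ψ : (Fin n → ℝ) → Fin d → ℝ,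
      ContDiff ℝ 2 Ψ ∧ HasCompactSupport Ψ ∧
        (∫ x : Fin n → ℝ, vnormSq (g x) (F x - Lop g Ψ x)) < ε := by
  intro ε hε
  have hgc := hg.continuous
  obtain ⟨S, hSm, hSt, hS⟩ := exists_measurable_matrix_sqrt g
    (fun i j => (hg i j).continuous.measurable) fun x => (hgpos x).posSemidef
  have hF := memLp_sqrt_mulVec hSm hSt hS hFm hFL2
  have hgFi := integrable_mulVec_of_integrable_vnormSq hgpos hgint hFm hFL2
  have hmem : hF.toLp _ ∈ (rangeSubmodule g S)ᗮᗮ := by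
    rw [Submodule.mem_orthogonal']
    intro G hG
    obtain ⟨c, hc⟩ := orthogonal_rangeSubmodule hg hgpos hSm hSt hS hG
    have hcF : ∫ x, ∑ i, c i * (g x *ᵥ F x) i = 0 := by
      rw [integral_finsetSum _ fun i _ => (hgFi i).const_mul (c i)]
      refine Finset.sum_eq_zero fun i _ => ?_
      rw [integral_const_mul, ← eval_integral hgFi, hFmean, Pi.zero_apply, mul_zero]
    rw [L2.inner_def, ← hcF]
    refine integral_congr_ae ?_
    filter_upwards [hF.coeFn_toLp, hc] with x hx hxc
    rw [hx, EuclideanSpace.inner_eq_star_dotProduct, star_trivial, ← mulVec_dotProduct_comm (hSt x),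
      hxc, mulVec_dotProduct_comm (transpose_eq_of_posSemidef (hgpos x).posSemidef)]
    rfl
  rw [Submodule.orthogonal_orthogonal_eq_closure, ← SetLike.mem_coe,
    Submodule.topologicalClosure_coe] at hmem
  obtain ⟨Φ, ⟨Ψ, hΨ, hΨc, hΦ⟩, hd⟩ := Metric.mem_closure_iff.1 hmem _ (Real.sqrt_pos.2 hε)
  refine ⟨Ψ, hΨ, hΨc, ?_⟩
  rw [dist_eq_norm, Real.lt_sqrt (norm_nonneg _), ← real_inner_self_eq_norm_sq, L2.inner_def] at hd
  refine lt_of_eq_of_lt (integral_congr_ae ?_) hd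
  filter_upwards [Lp.coeFn_sub (hF.toLp _) Φ, hF.coeFn_toLp, hΦ] with x hx hx1 hx2
  rw [hx, Pi.sub_apply, hx1, hx2, ← WithLp.toLp_sub, ← mulVec_sub, real_inner_self_eq_norm_sq,
    vnormSq_eq_norm_sq (hSt x) (hS x)]

end
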